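/- arXiv:0809.2304 — 6 statements merged into one kernel-verified Lean document; each statement's English description precedes it below -/
import Mathlib

section
/- Let L₁, L₂, L₃, M₁, M₂, M₃, N₁, N₂, N₃ be real numbers. Then the following are equivalent: (1) Lᵢ > 0 and Mᵢ > 0 for i = 1,2,3, and there exists a real number d such that for each i = 1,2,3 the symmetric 2×2 real matrix with diagonal entries Lᵢ, Mᵢ and both off-diagonal entries equal to Nᵢ + d is positive definite; (2) Lᵢ > 0 and Mᵢ > 0 for i = 1,2,3, and |Nᵢ − Nⱼ| < Real.sqrt (Lᵢ·Mᵢ) + Real.sqrt (Lⱼ·Mⱼ) for all i ≠ j. -/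
theorem posDef_two_iff (a b c : ℝ) (ha : 0 < a) (hb : 0 < b) :
    (!![a, c; c, b] : Matrix (Fin 2) (Fin 2) ℝ).PosDef ↔ |c| < Real.sqrt (a * b) := by
  rw [Real.lt_sqrt (abs_nonneg c), sq_abs]
  constructor
  · intro h
    have := h.det_pos
    rw [Matrix.det_fin_two_of] at this
    nlinarith
  · intro h
    refine Matrix.PosDef.of_dotProduct_mulVec_pos ?_ ?_
    · ext i j
      fin_cases i <;> fin_cases j <;> simp
    · intro x hx
      have key : 0 < a * (star x ⬝ᵥ (!![a, c; c, b] : Matrix (Fin 2) (Fin 2) ℝ).mulVec x) := by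
        have e : a * (star x ⬝ᵥ (!![a, c; c, b] : Matrix (Fin 2) (Fin 2) ℝ).mulVec x)
            = (a * x 0 + c * x 1) ^ 2 + (a * b - c ^ 2) * x 1 ^ 2 := by
          simp [Matrix.mulVec, dotProduct, Fin.sum_univ_two]
          ring
        rw [e]
        by_cases h1 : x 1 = 0
        · have h0 : x 0 ≠ 0 := by
            intro h0
            apply hx
            ext i
            fin_cases i <;> simp [h0, h1]
          rw [h1]
          have : a * x 0 ≠ 0 := mul_ne_zero ha.ne' h0
          have := sq_pos_of_ne_zero this
          simpa using this
        · have : 0 < x 1 ^ 2 := by positivity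
          have := mul_pos (sub_pos.2 h) this
          positivity
      exact pos_of_mul_pos_right key ha.le

theorem stmt_0 (L M N : Fin 3 → ℝ) :
    ((∀ i, 0 < L i ∧ 0 < M i) ∧
      ∃ d : ℝ, ∀ i, (!![L i, N i + d; N i + d, M i] : Matrix (Fin 2) (Fin 2) ℝ).PosDef)
    ↔
    ((∀ i, 0 < L i ∧ 0 < M i) ∧
      ∀ i j, i ≠ j →
        |N i - N j| < Real.sqrt (L i * M i) + Real.sqrt (L j * M j)) := by
  refine and_congr_right fun hp => ?_
  simp only [fun i d => posDef_two_iff (L i) (M i) (N i + d) (hp i).1 (hp i).2]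
  have hs : ∀ i, 0 < Real.sqrt (L i * M i) := fun i =>
    Real.sqrt_pos.2 (mul_pos (hp i).1 (hp i).2)
  generalize hS : (fun i => Real.sqrt (L i * M i)) = s
  have hS' : ∀ i, Real.sqrt (L i * M i) = s i := fun i => congrFun hS i
  simp only [hS'] at hs ⊢
  constructor
  · rintro ⟨d, hd⟩ i j -
    have h1 := abs_lt.1 (hd i)
    have h2 := abs_lt.1 (hd j)
    rw [abs_lt]
    constructor <;> linarith
  · intro h
    obtain ⟨p, hpm⟩ := Finite.exists_max (fun i => -N i - s i)
    obtain ⟨q, hq⟩ := Finite.exists_min (fun i => -N i + s i)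
    have hlt : -N p - s p < -N q + s q := by
      by_cases hpq : p = q
      · subst hpq
        linarith [hs p]
      · have := abs_lt.1 (h p q hpq)
        linarith
    refine ⟨((-N p - s p) + (-N q + s q)) / 2, fun i => ?_⟩
    have h1 := hpm i
    have h2 := hq i
    rw [abs_lt]
    constructor <;> linarith
end

section
/- Let β₁, β₂, β₃, γ₁, γ₂, γ₃ be positive real numbers, let (a₁, a₂, a₃) be a nonzero triple of real numbers and (b₀, b₁, b₂, b₃) a nonzero quadruple of real numbers. Then E := (b₀a₁β₁ + b₂a₃γ₃ − b₃a₂γ₂)² + (b₀a₂β₂ + b₃a₁γ₁ − b₁a₃γ₃)² + (b₀a₃β₃ + b₁a₂γ₂ − b₂a₁γ₁)² + (a₁b₁β₁ + a₂b₂β₂ + a₃b₃β₃)² > 0. -/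
theorem stmt_2 (β₁ β₂ β₃ γ₁ γ₂ γ₃ : ℝ)
    (hβ₁ : 0 < β₁) (hβ₂ : 0 < β₂) (hβ₃ : 0 < β₃)
    (hγ₁ : 0 < γ₁) (hγ₂ : 0 < γ₂) (hγ₃ : 0 < γ₃)
    (a₁ a₂ a₃ b₀ b₁ b₂ b₃ : ℝ)
    (ha : (a₁, a₂, a₃) ≠ ((0 : ℝ), (0 : ℝ), (0 : ℝ)))
    (hb : (b₀, b₁, b₂, b₃) ≠ ((0 : ℝ), (0 : ℝ), (0 : ℝ), (0 : ℝ))) :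
    0 < (b₀*a₁*β₁ + b₂*a₃*γ₃ - b₃*a₂*γ₂)^2
      + (b₀*a₂*β₂ + b₃*a₁*γ₁ - b₁*a₃*γ₃)^2
      + (b₀*a₃*β₃ + b₁*a₂*γ₂ - b₂*a₁*γ₁)^2
      + (a₁*b₁*β₁ + a₂*b₂*β₂ + a₃*b₃*β₃)^2 := by
  have hD : 0 < a₁^2*(β₁*γ₁) + a₂^2*(β₂*γ₂) + a₃^2*(β₃*γ₃) := by
    by_cases h1 : a₁ = 0
    · by_cases h2 : a₂ = 0
      · have h3 : a₃ ≠ 0 := by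
          intro h3
          exact ha (by rw [h1, h2, h3])
        positivity
      · positivity
    · positivity
  by_contra hE
  obtain ⟨e1, e2, e3, e4⟩ : b₀*a₁*β₁ + b₂*a₃*γ₃ - b₃*a₂*γ₂ = 0 ∧
      b₀*a₂*β₂ + b₃*a₁*γ₁ - b₁*a₃*γ₃ = 0 ∧
      b₀*a₃*β₃ + b₁*a₂*γ₂ - b₂*a₁*γ₁ = 0 ∧
      a₁*b₁*β₁ + a₂*b₂*β₂ + a₃*b₃*β₃ = 0 := by
    generalize b₀*a₁*β₁ + b₂*a₃*γ₃ - b₃*a₂*γ₂ = x at *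
    generalize b₀*a₂*β₂ + b₃*a₁*γ₁ - b₁*a₃*γ₃ = y at *
    generalize b₀*a₃*β₃ + b₁*a₂*γ₂ - b₂*a₁*γ₁ = z at *
    generalize a₁*b₁*β₁ + a₂*b₂*β₂ + a₃*b₃*β₃ = w at *
    have hx := sq_nonneg x
    have hy := sq_nonneg y
    have hz := sq_nonneg z
    have hw := sq_nonneg w
    refine ⟨?_, ?_, ?_, ?_⟩ <;> refine pow_eq_zero_iff (two_ne_zero) |>.mp ?_ <;> linarith
  have key : ∀ b : ℝ, b * (a₁^2*(β₁*γ₁) + a₂^2*(β₂*γ₂) + a₃^2*(β₃*γ₃)) = 0 → b = 0 :=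
    fun b h => (mul_eq_zero.mp h).resolve_right hD.ne'
  have h0 : b₀ = 0 := key _ (by linear_combination a₁*γ₁*e1 + a₂*γ₂*e2 + a₃*γ₃*e3)
  subst h0
  have h1 : b₁ = 0 := key _ (by
    linear_combination a₁*γ₁*e4 + a₂*β₂*e3 - a₃*β₃*e2)
  have h2 : b₂ = 0 := key _ (by
    linear_combination a₂*γ₂*e4 + a₃*β₃*e1 - a₁*β₁*e3)
  have h3 : b₃ = 0 := key _ (by
    linear_combination a₃*γ₃*e4 + a₁*β₁*e2 - a₂*β₂*e1)
  exact hb (by rw [h1, h2, h3])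
end

section
/- Let L, β, β' be real numbers with β ≠ 0. Then the following are equivalent: (1) there exists ε₀ > 0 such that for all ε with 0 < ε < ε₀ and all a ∈ ℝ, (L − 3εβ²)·a² − 2εβ'·a + ε²β² > 0; (2) (β')² < β²·L. -/
theorem stmt_3 (L β β' : ℝ) (hβ : β ≠ 0) :
    (∃ ε₀ > (0 : ℝ), ∀ ε : ℝ, 0 < ε → ε < ε₀ → ∀ a : ℝ,
        0 < (L - 3*ε*β^2) * a^2 - 2*ε*β' * a + ε^2 * β^2)
    ↔ β'^2 < β^2 * L := by
  have hb : 0 < β^2 := by positivity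
  have hb4 : 0 < β^4 := by positivity
  constructor
  · rintro ⟨e, he, h⟩
    have h1 := h (e/2) (by linarith) (by linarith)
    have hd := discrim_le_zero (a := L - 3*(e/2)*β^2) (b := -(2*(e/2)*β')) (c := (e/2)^2*β^2)
      (fun x => by nlinarith [h1 x])
    unfold discrim at hd
    have h2 : e^2 * (β'^2 - β^2 * (L - 3*(e/2)*β^2)) ≤ 0 := by linarith
    have h3 : β'^2 - β^2 * (L - 3*(e/2)*β^2) ≤ 0 := by
      by_contra hc
      push Not at hc
      have : 0 < e^2 * (β'^2 - β^2 * (L - 3*(e/2)*β^2)) := by positivity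
      linarith
    have h4 : 0 < e * β^4 := by positivity
    linarith
  · intro h
    refine ⟨(β^2*L - β'^2)/(3*β^4), div_pos (by linarith) (by positivity), ?_⟩
    intro ε hε hlt a
    rw [lt_div_iff₀ (by positivity)] at hlt
    have key : 0 < β^2 * ((L - 3*ε*β^2) * a^2 - 2*ε*β' * a + ε^2 * β^2) := by
      have e1 : β^2 * ((L - 3*ε*β^2) * a^2 - 2*ε*β' * a + ε^2 * β^2)
        = (ε*β^2 - β'*a)^2 + (β^2*L - β'^2 - ε*(3*β^4))*a^2 := by ring
      rw [e1]
      have hp : 0 < β^2*L - β'^2 - ε*(3*β^4) := by linarith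
      rcases eq_or_ne a 0 with rfl | ha
      · have : 0 < (ε*β^2)^2 := by positivity
        simpa using this
      · positivity
    exact pos_of_mul_pos_right key hb.le |> fun h => h
end

section
/- Let M, γ, B be real numbers with γ ≠ 0. Then the following are equivalent: (1) there exists ε₀ > 0 such that for all ε with 0 < ε < ε₀ and all a ∈ ℝ, ε²γ²·a² − 2εB·a + (M − 3εγ²) > 0; (2) B² < γ²·M. -/
theorem stmt_4 (M γ B : ℝ) (hγ : γ ≠ 0) :
    (∃ ε₀ > (0 : ℝ), ∀ ε : ℝ, 0 < ε → ε < ε₀ → ∀ a : ℝ,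
        0 < ε^2 * γ^2 * a^2 - 2*ε*B * a + (M - 3*ε*γ^2))
    ↔ B^2 < γ^2 * M := by
  have hg : 0 < γ^2 := by positivity
  have key : ∀ ε a : ℝ, γ^2 * (ε^2 * γ^2 * a^2 - 2*ε*B * a + (M - 3*ε*γ^2))
      = (ε * γ^2 * a - B)^2 + (γ^2 * M - B^2 - ε * (3 * (γ^2)^2)) := by
    intro ε a
    ring
  constructor
  · rintro ⟨ε₀, h0, h⟩
    have hp := mul_pos hg (h (ε₀/2) (by linarith) (by linarith) (B / (ε₀/2 * γ^2)))
    rw [key] at hp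
    have hz : ε₀/2 * γ^2 * (B / (ε₀/2 * γ^2)) - B = 0 := by
      field_simp
      ring
    rw [hz] at hp
    have : 0 < ε₀/2 * (3 * (γ^2)^2) := by positivity
    linarith
  · intro h
    have hd : 0 < 3 * (γ^2)^2 := by positivity
    refine ⟨(γ^2 * M - B^2) / (3 * (γ^2)^2), div_pos (by linarith) hd, ?_⟩
    intro ε _ hlt a
    rw [lt_div_iff₀ hd] at hlt
    refine pos_of_mul_pos_right (a := γ^2) ?_ hg.le
    rw [key]
    have := sq_nonneg (ε * γ^2 * a - B)
    linarith
end

section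
/- Let k and d be positive integers, and let g₁₁, g₁₂, g₂₂ : ℂ → ℝ satisfy, for all θ ∈ ℝ and all p ∈ ℂ: g₁₁(e^{ikθ}p) = cos²(dθ)g₁₁(p) + sin²(dθ)g₂₂(p) − 2 sin(dθ)cos(dθ)g₁₂(p); g₁₂(e^{ikθ}p) = (cos²(dθ) − sin²(dθ))g₁₂(p) − sin(dθ)cos(dθ)(g₂₂(p) − g₁₁(p)); g₂₂(e^{ikθ}p) = sin²(dθ)g₁₁(p) + cos²(dθ)g₂₂(p) + 2 sin(dθ)cos(dθ)g₁₂(p). Then g₁₁, g₁₂, g₂₂ are smooth (C^∞ as functions of two real variables on ℂ ≅ ℝ²) if and only if: either k divides 2d and there exist smooth functions φ₁, φ₂, φ₃ : ℝ → ℝ such that for all real t, (g₁₁ − g₂₂)(t) = t^{2d/k}·φ₁(t²), g₁₂(t) = t^{2d/k}·φ₂(t²), and (g₁₁ + g₂₂)(t) = φ₃(t²); or k does not divide 2d, and for all real t one has g₁₁(t) = g₂₂(t) and g₁₂(t) = 0, and there exists a smooth φ₃ : ℝ → ℝ with (g₁₁ + g₂₂)(t) = φ₃(t²). -/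
section helpers
open Filter Topology

theorem aux_contDiff_of_seq {E : Type*} [NormedAddCommGroup E] [NormedSpace ℝ E]
    (F : ℕ → ℝ → E) (hF : ∀ n x, HasDerivAt (F n) (F (n+1) x) x) :
    ContDiff ℝ (⊤ : ℕ∞) (F 0) := by
  have key : ∀ N : ℕ, ∀ n, ContDiff ℝ (N : ℕ∞) (F n) := by
    intro N
    induction N with
    | zero =>
      intro n
      simpa [contDiff_zero] using
        (continuous_iff_continuousAt.2 fun x => (hF n x).continuousAt)
    | succ N ih =>
      intro n
      have : ((N + 1 : ℕ) : ℕ∞) = ((N : ℕ∞) + 1 : ℕ∞) := by push_cast; rfl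
      have h2 : deriv (F n) = F (n+1) := funext fun x => (hF n x).deriv
      have := (contDiff_succ_iff_deriv (𝕜 := ℝ) (f := F n) (n := (N : ℕ∞))).2
        ⟨fun x => (hF n x).differentiableAt, by simp, by rw [h2]; exact ih _⟩
      simpa using this
  exact contDiff_infty.2 fun N => by simpa using key N 0

theorem aux_param {E : Type*} [NormedAddCommGroup E] [NormedSpace ℝ E] [CompleteSpace E]
    (h : ℝ → E) (hh : ContDiff ℝ (⊤ : ℕ∞) h) (m : ℕ) :
    ContDiff ℝ (⊤ : ℕ∞) (fun t => ∫ s in (0:ℝ)..1, s ^ m • h (s * t)) := by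
  have hc : ∀ n, ContDiff ℝ (⊤ : ℕ∞) (iteratedDeriv n h) := fun n =>
    hh.iterate_deriv n |> fun H => by rwa [iteratedDeriv_eq_iterate]
  have := aux_contDiff_of_seq
    (fun n t => ∫ s in (0:ℝ)..1, s ^ (m + n) • iteratedDeriv n h (s * t)) ?_
  · simpa using this
  intro n x
  have hcn := (hc n).continuous
  have hcn1 := (hc (n+1)).continuous
  obtain ⟨C, hC⟩ : ∃ C, ∀ p ∈ (Set.Icc (0:ℝ) 1) ×ˢ (Metric.closedBall x 1),
      ‖p.1 ^ (m + (n+1)) • iteratedDeriv (n+1) h (p.1 * p.2)‖ ≤ C := by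
    apply IsCompact.exists_bound_of_continuousOn
    · exact isCompact_Icc.prod (isCompact_closedBall _ _)
    · exact Continuous.continuousOn (by fun_prop)
  refine (intervalIntegral.hasDerivAt_integral_of_dominated_loc_of_deriv_le
    (bound := fun _ => C) (s := Metric.ball x 1)
    (F' := fun t s => s ^ (m + (n+1)) • iteratedDeriv (n+1) h (s * t))
    (Metric.ball_mem_nhds x one_pos) ?_ ?_ ?_ ?_ ?_ ?_).2
  · exact Eventually.of_forall fun t =>
      (Continuous.aestronglyMeasurable (by fun_prop))
  · exact Continuous.intervalIntegrable (by fun_prop) _ _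
  · exact (Continuous.aestronglyMeasurable (by fun_prop))
  · refine Eventually.of_forall fun s hs t ht => hC (s, t) ⟨?_, Metric.ball_subset_closedBall ht⟩
    rw [Set.uIoc_of_le zero_le_one] at hs
    exact ⟨hs.1.le, hs.2⟩
  · exact intervalIntegrable_const
  · refine Eventually.of_forall fun s hs t ht => ?_
    have h1 : HasDerivAt (iteratedDeriv n h) (iteratedDeriv (n+1) h (s*t)) (s*t) := by
      rw [iteratedDeriv_succ]
      exact ((hc n).differentiable (by simp) _).hasDerivAt
    have h2 : HasDerivAt (fun t : ℝ => s * t) s t := by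
      simpa using (hasDerivAt_id t).const_mul s
    have h3 := (h1.scomp t h2).const_smul (s ^ (m+n))
    refine HasDerivAt.congr_deriv h3 ?_
    rw [smul_smul, ← add_assoc, pow_succ]

/-- division: if f' = t^m h and f 0 = 0 then f = t^(m+1) * smooth -/
theorem aux_divide {E : Type*} [NormedAddCommGroup E] [NormedSpace ℝ E] [CompleteSpace E]
    (f h : ℝ → E) (hf : ContDiff ℝ (⊤ : ℕ∞) f) (hh : ContDiff ℝ (⊤ : ℕ∞) h) (m : ℕ)
    (h0 : f 0 = 0) (hd : ∀ t, deriv f t = t ^ m • h t) :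
    ∃ q : ℝ → E, ContDiff ℝ (⊤ : ℕ∞) q ∧ ∀ t, f t = t ^ (m+1) • q t := by
  refine ⟨_, aux_param h hh m, fun t => ?_⟩
  have hdc : Continuous (deriv f) := hf.continuous_deriv (by simp)
  have h1 : ∫ s in (0:ℝ)..1, t • deriv f (s * t) = f t - f 0 := by
    have := intervalIntegral.integral_eq_sub_of_hasDerivAt (a := 0) (b := 1)
      (f := fun s : ℝ => f (s * t)) (f' := fun s => t • deriv f (s * t)) ?_ ?_
    · simpa using this
    · intro s _
      have h1 : HasDerivAt f (deriv f (s*t)) (s*t) :=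
        (hf.differentiable (by simp) _).hasDerivAt
      have h2 : HasDerivAt (fun s : ℝ => s * t) t s := by
        simpa using (hasDerivAt_id s).mul_const t
      exact h1.scomp s h2
    · exact Continuous.intervalIntegrable (by fun_prop) _ _
  rw [h0, sub_zero] at h1
  rw [← h1, ← intervalIntegral.integral_smul]
  congr 1
  ext s
  rw [hd, smul_smul, smul_smul]
  congr 1
  ring

theorem aux_borel (a : ℕ → ℝ) : ∃ ψ : ℝ → ℝ, ContDiff ℝ (⊤ : ℕ∞) ψ ∧
    ∀ n, iteratedDeriv n ψ 0 = a n := by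
  let χ : ContDiffBump (0:ℝ) := ⟨1, 2, one_pos, one_lt_two⟩
  let η : ℕ → ℝ → ℝ := fun n y => y ^ n * χ y
  have hη : ∀ n, ContDiff ℝ (⊤ : ℕ∞) (η n) := fun n =>
    (contDiff_id.pow n).mul χ.contDiff
  have hηs : ∀ n, HasCompactSupport (η n) := fun n => χ.hasCompactSupport.mul_left
  have hB : ∀ n k, ∃ B : ℝ, ∀ x, ‖iteratedDeriv k (η n) x‖ ≤ B := by
    intro n k
    have h1 : HasCompactSupport (iteratedFDeriv ℝ k (η n)) := (hηs n).iteratedFDeriv k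
    have h2 : Continuous (iteratedFDeriv ℝ k (η n)) :=
      (hη n).continuous_iteratedFDeriv (by exact_mod_cast le_top)
    obtain ⟨C, hC⟩ := h1.exists_bound_of_continuous h2
    exact ⟨C, fun x => by rw [← norm_iteratedFDeriv_eq_norm_iteratedDeriv]; exact hC x⟩
  choose B hB using hB
  have hB0 : ∀ n k, 0 ≤ B n k := fun n k => (norm_nonneg _).trans (hB n k 0)
  let b : ℕ → ℝ := fun n => a n / n.factorial
  let M : ℕ → ℝ := fun n => 1 + 2 ^ n * |b n| * ∑ k ∈ Finset.range n, B n k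
  have hM1 : ∀ n, 1 ≤ M n := fun n => by
    have : 0 ≤ ∑ k ∈ Finset.range n, B n k := Finset.sum_nonneg fun k _ => hB0 n k
    simp only [M]
    have : 0 ≤ 2 ^ n * |b n| * ∑ k ∈ Finset.range n, B n k := by positivity
    linarith
  have hM0 : ∀ n, 0 < M n := fun n => lt_of_lt_of_le one_pos (hM1 n)
  let f : ℕ → ℝ → ℝ := fun n x => (b n * (M n ^ n)⁻¹) * η n (M n * x)
  have hf : ∀ n, ContDiff ℝ (⊤ : ℕ∞) (f n) := fun n =>
    contDiff_const.mul ((hη n).comp (contDiff_const.mul contDiff_id))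
  have hfd : ∀ n k x, iteratedDeriv k (f n) x =
      (b n * (M n ^ n)⁻¹) * (M n ^ k * iteratedDeriv k (η n) (M n * x)) := by
    intro n k x
    simp only [f]
    rw [iteratedDeriv_const_mul_field, iteratedDeriv_comp_const_mul
      ((hη n).of_le (by exact_mod_cast le_top))]
  have hfb : ∀ n k x, ‖iteratedDeriv k (f n) x‖ ≤ |b n| * (M n ^ n)⁻¹ * (M n ^ k * B n k) := by
    intro n k x
    have hp := hM0 n
    rw [hfd, norm_mul, norm_mul, norm_mul, Real.norm_eq_abs, Real.norm_eq_abs (_⁻¹),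
      Real.norm_eq_abs (M n ^ k), abs_of_pos (show 0 < (M n ^ n)⁻¹ by positivity),
      abs_of_pos (show 0 < M n ^ k by positivity)]
    gcongr
    exact hB _ _ _
  have hfb2 : ∀ n k, k < n → |b n| * (M n ^ n)⁻¹ * (M n ^ k * B n k) ≤ (1/2:ℝ) ^ n := by
    intro n k hkn
    have hp := hM0 n
    have h1 : (M n ^ n)⁻¹ * M n ^ k ≤ (M n)⁻¹ := by
      rw [inv_mul_le_iff₀ (by positivity)]
      obtain ⟨j, rfl⟩ : ∃ j, n = k + 1 + j := ⟨n - (k+1), by omega⟩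
      rw [pow_add, pow_succ]
      have : 1 ≤ M (k+1+j) ^ j := one_le_pow₀ (hM1 _)
      have h3 : 0 < M (k+1+j) ^ k := by positivity
      field_simp
      linarith
    have h2 : B n k ≤ ∑ k ∈ Finset.range n, B n k :=
      Finset.single_le_sum (f := fun k => B n k) (fun k _ => hB0 n k) (Finset.mem_range.2 hkn)
    have h3 : 2 ^ n * |b n| * B n k ≤ M n := by
      have : 2 ^ n * |b n| * B n k ≤ 2 ^ n * |b n| * ∑ k ∈ Finset.range n, B n k := by gcongr
      simp only [M]; linarith
    calc |b n| * (M n ^ n)⁻¹ * (M n ^ k * B n k)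
        = |b n| * B n k * ((M n ^ n)⁻¹ * M n ^ k) := by ring
      _ ≤ |b n| * B n k * (M n)⁻¹ := by
          have := hB0 n k
          gcongr
      _ ≤ (1/2:ℝ) ^ n := by
          rw [mul_inv_le_iff₀ hp, one_div, inv_pow, ← div_eq_inv_mul, le_div_iff₀ (by positivity)]
          linarith
  let v : ℕ → ℕ → ℝ := fun k n =>
    if k < n then (1/2:ℝ) ^ n else |b n| * (M n ^ n)⁻¹ * (M n ^ k * B n k)
  have hv : ∀ k, Summable (v k) := by
    intro k
    have hs : Summable (fun n : ℕ => (1/2:ℝ) ^ n) := summable_geometric_two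
    refine (summable_congr_cofinite ?_).2 hs
    rw [Nat.cofinite_eq_atTop]
    filter_upwards [eventually_gt_atTop k] with n hn
    simp [v, hn]
  have hvb : ∀ (k n : ℕ) (x : ℝ), ‖iteratedFDeriv ℝ k (f n) x‖ ≤ v k n := by
    intro k n x
    rw [norm_iteratedFDeriv_eq_norm_iteratedDeriv]
    refine (hfb n k x).trans ?_
    simp only [v]
    split_ifs with h
    · exact hfb2 n k h
    · exact le_rfl
  refine ⟨fun x => ∑' n, f n x, ?_, ?_⟩
  · exact contDiff_tsum (v := v) (N := (⊤ : ℕ∞)) hf (fun k _ => hv k) (fun k n x _ => hvb k n x)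
  · intro k
    have h1 : iteratedDeriv k (fun x => ∑' n, f n x) 0 = ∑' n, iteratedDeriv k (f n) 0 := by
      rw [iteratedDeriv_eq_iteratedFDeriv,
        iteratedFDeriv_tsum (v := v) (N := (⊤ : ℕ∞)) hf (fun k _ => hv k)
          (fun k n x _ => hvb k n x) (k := k) le_top]
      rw [ContinuousMultilinearMap.tsum_eval]
      · simp only [iteratedDeriv_eq_iteratedFDeriv]
      · exact Summable.of_norm_bounded (hv k) (fun n => hvb k n 0)
    rw [h1]
    have h2 : ∀ n, iteratedDeriv k (η n) 0 = if k = n then (k.factorial : ℝ) else 0 := by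
      intro n
      have : η n =ᶠ[𝓝 0] fun x => x ^ n := by
        filter_upwards [χ.eventuallyEq_one] with x hx
        simp [η, hx]
      rw [this.iteratedDeriv_eq, iteratedDeriv_fun_pow_zero]
      split_ifs with h <;> simp [h]
    rw [tsum_eq_single k]
    · have := hM0 k
      rw [hfd, mul_zero, h2, if_pos rfl]
      simp only [b]
      field_simp
    · intro n hn
      rw [hfd, mul_zero, h2, if_neg (Ne.symm hn)]
      simp

theorem aux_whitney (h : ℝ → ℝ) (hh : ContDiff ℝ (⊤ : ℕ∞) h) (he : ∀ t, h (-t) = h t) :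
    ∃ φ : ℝ → ℝ, ContDiff ℝ (⊤ : ℕ∞) φ ∧ ∀ t, h t = φ (t ^ 2) := by
  let T := {h : ℝ → ℝ // ContDiff ℝ (⊤ : ℕ∞) h ∧ ∀ t, h (-t) = h t}
  have step : ∀ h : T, ∃ q : T, ∀ t, deriv h.1 t = 2 * t * q.1 t := by
    rintro ⟨h, hh, he⟩
    have hd : ContDiff ℝ (⊤ : ℕ∞) (deriv h) := (contDiff_infty_iff_deriv.1 hh).2
    have hdd : ContDiff ℝ (⊤ : ℕ∞) (deriv (deriv h)) := (contDiff_infty_iff_deriv.1 hd).2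
    have hodd : ∀ t, deriv h (-t) = - deriv h t := by
      intro t
      have h1 : deriv (fun x => h (-x)) t = deriv h t := by simp only [he]
      rw [deriv_comp_neg] at h1
      linarith
    have h0 : deriv h 0 = 0 := by
      have := hodd 0
      simp at this
      linarith
    obtain ⟨q, hq, hq2⟩ := aux_divide (deriv h) _ hd hdd 0 h0 (by simp)
    refine ⟨⟨fun t => q t / 2, hq.div_const _, ?_⟩, ?_⟩
    · intro t
      rcases eq_or_ne t 0 with rfl | ht
      · simp
      · have h1 := hodd t
        rw [hq2, hq2] at h1
        simp only [zero_add, pow_one, smul_eq_mul] at h1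
        have : t * q (-t) = t * q t := by linarith
        simp only [mul_left_cancel₀ ht this]
    · intro t
      simp only [hq2, zero_add, pow_one, smul_eq_mul]
      ring
  choose nxt hnxt using step
  let H : ℕ → T := fun n => nxt^[n] ⟨h, hh, he⟩
  have hH : ∀ n t, HasDerivAt (H n).1 (2 * t * (H (n+1)).1 t) t := by
    intro n t
    have : H (n+1) = nxt (H n) := Function.iterate_succ_apply' _ _ _
    rw [this, ← hnxt]
    exact ((H n).2.1.differentiable (by simp) t).hasDerivAt
  obtain ⟨ψ, hψ, hψ0⟩ := aux_borel fun n => (H n).1 0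
  have hψc : ∀ n, ContDiff ℝ (⊤ : ℕ∞) (iteratedDeriv n ψ) := fun n =>
    hψ.iterate_deriv n |> fun H => by rwa [iteratedDeriv_eq_iterate]
  let Φ : ℕ → ℝ → ℝ := fun n x => if 0 ≤ x then (H n).1 (√x) else iteratedDeriv n ψ x
  have hΦc : ∀ n, Continuous (Φ n) := by
    intro n
    refine Continuous.if_le ((H n).2.1.continuous.comp Real.continuous_sqrt)
      (hψc n).continuous continuous_const continuous_id ?_
    rintro x rfl
    simp [hψ0]
  have hΦd : ∀ n x, HasDerivAt (Φ n) (Φ (n+1) x) x := by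
    intro n
    have hne : ∀ y, y ≠ 0 → HasDerivAt (Φ n) (Φ (n+1) y) y := by
      intro y hy
      rcases lt_or_gt_of_ne hy with hy | hy
      · have h1 : HasDerivAt (iteratedDeriv n ψ) (Φ (n+1) y) y := by
          simp only [Φ, if_neg (not_le.2 hy)]
          rw [iteratedDeriv_succ]
          exact ((hψc n).differentiable (by simp) _).hasDerivAt
        refine h1.congr_of_eventuallyEq ?_
        filter_upwards [Iio_mem_nhds hy] with x hx
        simp only [Φ, if_neg (not_le.2 (Set.mem_Iio.1 hx))]
      · have h1 : HasDerivAt (fun x => (H n).1 (√x)) (Φ (n+1) y) y := by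
          simp only [Φ, if_pos hy.le]
          have := (hH n (√y)).comp y (Real.hasDerivAt_sqrt hy.ne')
          refine HasDerivAt.congr_deriv this ?_
          have : √y ≠ 0 := (Real.sqrt_pos.2 hy).ne'
          field_simp
        refine h1.congr_of_eventuallyEq ?_
        filter_upwards [Ioi_mem_nhds hy] with x hx
        simp only [Φ, if_pos (le_of_lt (Set.mem_Ioi.1 hx))]
    exact hasDerivAt_of_hasDerivAt_of_ne' hne (hΦc n).continuousAt (hΦc (n+1)).continuousAt
  refine ⟨Φ 0, aux_contDiff_of_seq Φ hΦd, fun t => ?_⟩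
  simp only [Φ, if_pos (sq_nonneg t), Real.sqrt_sq_eq_abs]
  change h t = h |t|
  rcases abs_choice t with h | h <;> rw [h]
  exact (he t).symm

theorem aux_weight (m : ℕ) : ∀ M : ℕ, m ≤ M → ∀ W : ℂ → ℂ, ContDiff ℝ (⊤ : ℕ∞) W →
    (∀ (α : ℝ) (p : ℂ), W (Complex.exp (α * Complex.I) * p) =
      Complex.exp (α * Complex.I) ^ M * W p) →
    ∃ h : ℝ → ℂ, ContDiff ℝ (⊤ : ℕ∞) h ∧ ∀ t : ℝ, W t = t ^ m • h t := by
  induction m with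
  | zero =>
    intro M _ W hW _
    exact ⟨fun t => W t, hW.comp Complex.ofRealCLM.contDiff, by simp⟩
  | succ m ih =>
    intro M hM W hW hinv
    obtain ⟨N, rfl⟩ : ∃ N, M = N + 1 := ⟨M - 1, by omega⟩
    have h0 : W 0 = 0 := by
      have h1 := hinv (Real.pi / (N+1)) 0
      rw [← Complex.exp_nat_mul] at h1
      have h2 : ((N + 1 : ℕ) : ℂ) * (((Real.pi / (N+1) : ℝ) : ℂ) * Complex.I)
          = Real.pi * Complex.I := by
        have : (N : ℂ) + 1 ≠ 0 := by exact_mod_cast N.succ_ne_zero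
        push_cast
        field_simp
      rw [h2, Complex.exp_pi_mul_I, mul_zero] at h1
      linear_combination (1/2) * h1
    have hdiff : Differentiable ℝ W := hW.differentiable (by simp)
    have hfd : ContDiff ℝ (⊤ : ℕ∞) (fderiv ℝ W) := hW.fderiv_right (by simp)
    have hA : ContDiff ℝ (⊤ : ℕ∞) (fun p => fderiv ℝ W p 1) := hfd.clm_apply contDiff_const
    have hB : ContDiff ℝ (⊤ : ℕ∞) (fun p => fderiv ℝ W p Complex.I) :=
      hfd.clm_apply contDiff_const
    have heq : ∀ (α : ℝ) (p v : ℂ),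
        fderiv ℝ W (Complex.exp (α * Complex.I) * p) (Complex.exp (α * Complex.I) * v) =
          Complex.exp (α * Complex.I) ^ (N+1) * fderiv ℝ W p v := by
      intro α p v
      set u := Complex.exp (α * Complex.I)
      have h1 : HasFDerivAt (fun p : ℂ => u * p) (ContinuousLinearMap.mul ℝ ℂ u) p :=
        (ContinuousLinearMap.mul ℝ ℂ u).hasFDerivAt
      have h2 := (hdiff (u * p)).hasFDerivAt.comp p h1
      have h3 : HasFDerivAt (fun p => u ^ (N+1) * W p) (u ^ (N+1) • fderiv ℝ W p) p :=
        (hdiff p).hasFDerivAt.const_mul _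
      have h4 : (W ∘ fun p : ℂ => u * p) = fun p => u ^ (N+1) * W p := funext fun p => hinv α p
      rw [h4] at h2
      have h5 := DFunLike.congr_fun (h2.unique h3) v
      simpa using h5
    have hcs : ∀ (α : ℝ) (p : ℂ),
        fderiv ℝ W (Complex.exp (α * Complex.I) * p) 1 = Complex.exp (α * Complex.I) ^ (N+1) *
          (Real.cos α * fderiv ℝ W p 1 - Real.sin α * fderiv ℝ W p Complex.I) ∧
        fderiv ℝ W (Complex.exp (α * Complex.I) * p) Complex.I =
          Complex.exp (α * Complex.I) ^ (N+1) *
          (Real.sin α * fderiv ℝ W p 1 + Real.cos α * fderiv ℝ W p Complex.I) := by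
      intro α p
      have hI := Complex.I_mul_I
      have hc : (Real.cos α : ℂ) ^ 2 + (Real.sin α : ℂ) ^ 2 = 1 := by
        exact_mod_cast Real.cos_sq_add_sin_sq α
      have hu : Complex.exp (α * Complex.I) = Real.cos α + Real.sin α * Complex.I := by
        rw [Complex.exp_mul_I, Complex.ofReal_cos, Complex.ofReal_sin]
      have e1 := heq α p (Real.cos α - Real.sin α * Complex.I)
      have e2 := heq α p (Real.sin α + Real.cos α * Complex.I)
      have f1 : Complex.exp (α * Complex.I) * (Real.cos α - Real.sin α * Complex.I) = 1 := by
        rw [hu]; linear_combination hc - (Real.sin α : ℂ)^2 * hI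
      have f2 : Complex.exp (α * Complex.I) * (Real.sin α + Real.cos α * Complex.I)
          = Complex.I := by
        rw [hu]; linear_combination Complex.I * hc + (Real.cos α * Real.sin α : ℂ) * hI
      have g1 : (Real.cos α - Real.sin α * Complex.I : ℂ)
          = Real.cos α • (1:ℂ) - Real.sin α • Complex.I := by
        simp only [Complex.real_smul, mul_one]
      have g2 : (Real.sin α + Real.cos α * Complex.I : ℂ)
          = Real.sin α • (1:ℂ) + Real.cos α • Complex.I := by
        simp only [Complex.real_smul, mul_one]
      rw [f1, g1, map_sub, map_smul, map_smul, Complex.real_smul, Complex.real_smul] at e1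
      rw [f2, g2, map_add, map_smul, map_smul, Complex.real_smul, Complex.real_smul] at e2
      exact ⟨e1, e2⟩
    obtain ⟨hP, hPs, hP2⟩ := ih N (by omega)
      (fun p => fderiv ℝ W p 1 - Complex.I * fderiv ℝ W p Complex.I)
      (hA.sub (contDiff_const.mul hB)) (by
        intro α p
        have hI := Complex.I_mul_I
        have hc : (Real.cos α : ℂ) ^ 2 + (Real.sin α : ℂ) ^ 2 = 1 := by
          exact_mod_cast Real.cos_sq_add_sin_sq α
        have hu : Complex.exp (α * Complex.I) = Real.cos α + Real.sin α * Complex.I := by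
          rw [Complex.exp_mul_I, Complex.ofReal_cos, Complex.ofReal_sin]
        have f1 : Complex.exp (α * Complex.I) * (Real.cos α - Real.sin α * Complex.I) = 1 := by
          rw [hu]; linear_combination hc - (Real.sin α : ℂ)^2 * hI
        simp only [(hcs α p).1, (hcs α p).2]
        rw [pow_succ]
        linear_combination (Complex.exp (α * Complex.I) ^ N * (fderiv ℝ W p 1 -
          Complex.I * fderiv ℝ W p Complex.I)) * f1 + (-Complex.exp (α * Complex.I) ^ N
            * Complex.exp (α * Complex.I) * Real.sin α * fderiv ℝ W p Complex.I) * hI)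
    obtain ⟨hQ, hQs, hQ2⟩ := ih (N+2) (by omega)
      (fun p => fderiv ℝ W p 1 + Complex.I * fderiv ℝ W p Complex.I)
      (hA.add (contDiff_const.mul hB)) (by
        intro α p
        have hI := Complex.I_mul_I
        have hu : Complex.exp (α * Complex.I) = Real.cos α + Real.sin α * Complex.I := by
          rw [Complex.exp_mul_I, Complex.ofReal_cos, Complex.ofReal_sin]
        simp only [(hcs α p).1, (hcs α p).2]
        rw [pow_succ _ (N+1)]
        linear_combination (-Complex.exp (α * Complex.I) ^ (N+1) * (fderiv ℝ W p 1 +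
          Complex.I * fderiv ℝ W p Complex.I)) * hu + (-Complex.exp (α * Complex.I) ^ (N+1)
            * Real.sin α * fderiv ℝ W p Complex.I) * hI)
    refine aux_divide (fun t : ℝ => W t) (fun t => (1/2 : ℝ) • (hP t + hQ t))
      (hW.comp Complex.ofRealCLM.contDiff) ((hPs.add hQs).const_smul _) m (by simpa using h0) ?_
    intro t
    have h1 : HasDerivAt (fun t : ℝ => W t) (fderiv ℝ W t 1) t :=
      (hdiff t).hasFDerivAt.comp_hasDerivAt t Complex.ofRealCLM.hasDerivAt
    rw [h1.deriv]
    have e1 := hP2 t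
    have e2 := hQ2 t
    simp only [Complex.real_smul] at e1 e2 ⊢
    push_cast at e1 e2 ⊢
    linear_combination (1/2) * (e1 + e2)

/-- the structure theorem for equivariant smooth functions -/
theorem aux_equiv (m : ℕ) (W : ℂ → ℂ) (hW : ContDiff ℝ (⊤ : ℕ∞) W)
    (hinv : ∀ (α : ℝ) (p : ℂ), W (Complex.exp (α * Complex.I) * p) =
      Complex.exp (α * Complex.I) ^ m * W p) :
    ∃ φ₁ φ₂ : ℝ → ℝ, ContDiff ℝ (⊤ : ℕ∞) φ₁ ∧ ContDiff ℝ (⊤ : ℕ∞) φ₂ ∧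
      ∀ t : ℝ, (W t).re = t ^ m * φ₁ (t ^ 2) ∧ (W t).im = t ^ m * φ₂ (t ^ 2) := by
  obtain ⟨h, hh, hWh⟩ := aux_weight m m le_rfl W hW hinv
  have heven : ∀ t, h (-t) = h t := by
    intro t
    rcases eq_or_ne t 0 with rfl | ht
    · simp
    · have h1 := hinv Real.pi t
      rw [Complex.exp_pi_mul_I, neg_one_mul, ← Complex.ofReal_neg, hWh, hWh] at h1
      have h2 : ((-1 : ℂ) ^ m * (t : ℂ) ^ m) ≠ 0 := by
        have : (t : ℂ) ≠ 0 := by exact_mod_cast ht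
        exact mul_ne_zero (pow_ne_zero _ (by norm_num)) (pow_ne_zero _ this)
      apply mul_left_cancel₀ h2
      simp only [Complex.real_smul] at h1
      push_cast at h1
      rw [neg_pow] at h1
      linear_combination h1
  obtain ⟨φ₁, h1, h1'⟩ := aux_whitney (fun t => (h t).re) (Complex.reCLM.contDiff.comp hh)
    (fun t => by rw [heven])
  obtain ⟨φ₂, h2, h2'⟩ := aux_whitney (fun t => (h t).im) (Complex.imCLM.contDiff.comp hh)
    (fun t => by rw [heven])
  refine ⟨φ₁, φ₂, h1, h2, fun t => ?_⟩
  rw [hWh, ← h1', ← h2', Complex.smul_re, Complex.smul_im]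
  simp

/-- converse -/
theorem aux_conv (m : ℕ) (W : ℂ → ℂ)
    (hinv : ∀ (α : ℝ) (p : ℂ), W (Complex.exp (α * Complex.I) * p) =
      Complex.exp (α * Complex.I) ^ m * W p)
    (φ₁ φ₂ : ℝ → ℝ) (h1 : ContDiff ℝ (⊤ : ℕ∞) φ₁) (h2 : ContDiff ℝ (⊤ : ℕ∞) φ₂)
    (h : ∀ t : ℝ, (W t).re = t ^ m * φ₁ (t ^ 2) ∧ (W t).im = t ^ m * φ₂ (t ^ 2)) :
    ContDiff ℝ (⊤ : ℕ∞) W := by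
  have key : W = fun z => z ^ m * ((φ₁ (‖z‖ ^ 2) : ℂ) + φ₂ (‖z‖ ^ 2) * Complex.I) := by
    funext z
    have hz : W ‖z‖ = (‖z‖ : ℂ) ^ m * ((φ₁ (‖z‖ ^ 2) : ℂ) + φ₂ (‖z‖ ^ 2) * Complex.I) := by
      rw [← Complex.re_add_im (W ‖z‖), (h ‖z‖).1, (h ‖z‖).2]
      push_cast
      ring
    have h3 := hinv z.arg ‖z‖
    rw [mul_comm (Complex.exp _) (‖z‖ : ℂ), Complex.norm_mul_exp_arg_mul_I, hz] at h3
    have h4 : z ^ m = (‖z‖ : ℂ) ^ m * Complex.exp (z.arg * Complex.I) ^ m := by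
      rw [← mul_pow, Complex.norm_mul_exp_arg_mul_I]
    rw [h3, h4]
    ring
  rw [key]
  have hn : ContDiff ℝ (⊤ : ℕ∞) (fun z : ℂ => ‖z‖ ^ 2) := contDiff_norm_sq ℝ
  exact (contDiff_id.pow m).mul ((Complex.ofRealCLM.contDiff.comp (h1.comp hn)).add
    ((Complex.ofRealCLM.contDiff.comp (h2.comp hn)).mul contDiff_const))

end helpers


theorem stmt_6 (k d : ℕ) (hk : 0 < k) (hd : 0 < d)
    (g₁₁ g₁₂ g₂₂ : ℂ → ℝ)
    (hinv₁₁ : ∀ (θ : ℝ) (p : ℂ),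
      g₁₁ (Complex.exp (Complex.I * ((k : ℝ) * θ)) * p) =
        Real.cos ((d : ℝ) * θ)^2 * g₁₁ p + Real.sin ((d : ℝ) * θ)^2 * g₂₂ p
          - 2 * Real.sin ((d : ℝ) * θ) * Real.cos ((d : ℝ) * θ) * g₁₂ p)
    (hinv₁₂ : ∀ (θ : ℝ) (p : ℂ),
      g₁₂ (Complex.exp (Complex.I * ((k : ℝ) * θ)) * p) =
        (Real.cos ((d : ℝ) * θ)^2 - Real.sin ((d : ℝ) * θ)^2) * g₁₂ p
          - Real.sin ((d : ℝ) * θ) * Real.cos ((d : ℝ) * θ) * (g₂₂ p - g₁₁ p))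
    (hinv₂₂ : ∀ (θ : ℝ) (p : ℂ),
      g₂₂ (Complex.exp (Complex.I * ((k : ℝ) * θ)) * p) =
        Real.sin ((d : ℝ) * θ)^2 * g₁₁ p + Real.cos ((d : ℝ) * θ)^2 * g₂₂ p
          + 2 * Real.sin ((d : ℝ) * θ) * Real.cos ((d : ℝ) * θ) * g₁₂ p) :
    (ContDiff ℝ (⊤ : ℕ∞) g₁₁ ∧ ContDiff ℝ (⊤ : ℕ∞) g₁₂ ∧ ContDiff ℝ (⊤ : ℕ∞) g₂₂)
    ↔
    ((k ∣ 2*d ∧ ∃ φ₁ φ₂ φ₃ : ℝ → ℝ,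
        ContDiff ℝ (⊤ : ℕ∞) φ₁ ∧ ContDiff ℝ (⊤ : ℕ∞) φ₂ ∧ ContDiff ℝ (⊤ : ℕ∞) φ₃ ∧
        ∀ t : ℝ,
          g₁₁ (t : ℂ) - g₂₂ (t : ℂ) = t ^ (2*d/k) * φ₁ (t^2) ∧
          g₁₂ (t : ℂ) = t ^ (2*d/k) * φ₂ (t^2) ∧
          g₁₁ (t : ℂ) + g₂₂ (t : ℂ) = φ₃ (t^2))
     ∨ (¬ (k ∣ 2*d) ∧
        (∀ t : ℝ, g₁₁ (t : ℂ) = g₂₂ (t : ℂ) ∧ g₁₂ (t : ℂ) = 0) ∧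
        ∃ φ₃ : ℝ → ℝ, ContDiff ℝ (⊤ : ℕ∞) φ₃ ∧
          ∀ t : ℝ, g₁₁ (t : ℂ) + g₂₂ (t : ℂ) = φ₃ (t^2))) := by
  have hk0 : (k : ℝ) ≠ 0 := by positivity
  have hkc : (k : ℂ) ≠ 0 := by exact_mod_cast hk.ne'
  set W : ℂ → ℂ := fun p => ((g₁₁ p - g₂₂ p : ℝ) : ℂ) + ((2 * g₁₂ p : ℝ) : ℂ) * Complex.I with hW
  set S : ℂ → ℂ := fun p => ((g₁₁ p + g₂₂ p : ℝ) : ℂ) with hS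
  have hWre : ∀ p, (W p).re = g₁₁ p - g₂₂ p := fun p => by simp [hW]
  have hWim : ∀ p, (W p).im = 2 * g₁₂ p := fun p => by simp [hW]
  have hSre : ∀ p, (S p).re = g₁₁ p + g₂₂ p := fun p => by simp [hS]
  have hSim : ∀ p, (S p).im = 0 := fun p => by simp [hS]
  have hWθ : ∀ (θ : ℝ) (p : ℂ), W (Complex.exp (Complex.I * ((k : ℝ) * θ)) * p) =
      Complex.exp (((2 * d * θ : ℝ) : ℂ) * Complex.I) * W p := by
    intro θ p
    have hu : Complex.exp (((2 * d * θ : ℝ) : ℂ) * Complex.I)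
        = ((Real.cos (2 * (d * θ)) : ℝ) : ℂ) + ((Real.sin (2 * (d * θ)) : ℝ) : ℂ) * Complex.I := by
      rw [Complex.exp_mul_I, Complex.ofReal_cos, Complex.ofReal_sin, mul_assoc 2 (d:ℝ) θ]
    rw [hu, Real.cos_two_mul', Real.sin_two_mul]
    apply Complex.ext
    · simp only [Complex.add_re, Complex.mul_re, Complex.add_im, Complex.mul_im, hWre, hWim,
        Complex.ofReal_re, Complex.ofReal_im, Complex.I_re, Complex.I_im, hinv₁₁, hinv₂₂]
      ring
    · simp only [Complex.add_re, Complex.mul_re, Complex.add_im, Complex.mul_im, hWre, hWim,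
        Complex.ofReal_re, Complex.ofReal_im, Complex.I_re, Complex.I_im, hinv₁₂]
      ring
  have hSα : ∀ (α : ℝ) (p : ℂ), S (Complex.exp (α * Complex.I) * p) =
      Complex.exp (α * Complex.I) ^ 0 * S p := by
    intro α p
    have h1 := hinv₁₁ (α / k) p
    have h2 := hinv₂₂ (α / k) p
    have e : Complex.I * (((k : ℝ) : ℂ) * ((α / k : ℝ) : ℂ)) = α * Complex.I := by
      push_cast
      field_simp
    rw [e] at h1 h2
    rw [pow_zero, one_mul]
    simp only [hS]
    rw [h1, h2]
    congr 1
    linear_combination (g₁₁ p + g₂₂ p) * Real.sin_sq_add_cos_sq (d * (α / k))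
  have hWα : k ∣ 2 * d → ∀ (α : ℝ) (p : ℂ), W (Complex.exp (α * Complex.I) * p) =
      Complex.exp (α * Complex.I) ^ (2 * d / k) * W p := by
    rintro hdvd α p
    obtain ⟨m, hm⟩ := hdvd
    have hmd : 2 * d / k = m := by rw [hm]; exact Nat.mul_div_cancel_left m hk
    have h1 := hWθ (α / k) p
    have e : Complex.I * (((k : ℝ) : ℂ) * ((α / k : ℝ) : ℂ)) = α * Complex.I := by
      push_cast
      field_simp
    have hm' : (2 : ℂ) * d = k * m := by exact_mod_cast hm
    rw [e] at h1
    rw [h1, hmd, ← Complex.exp_nat_mul]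
    congr 2
    push_cast
    rw [hm']
    field_simp
  have hW0 : ¬ k ∣ 2 * d → ∀ p, W p = 0 := by
    intro hnd p
    have h1 := hWθ (2 * Real.pi / k) p
    have e : Complex.I * (((k : ℝ) : ℂ) * ((2 * Real.pi / k : ℝ) : ℂ))
        = 2 * Real.pi * Complex.I := by
      push_cast
      field_simp
    rw [e, Complex.exp_two_pi_mul_I, one_mul] at h1
    by_contra hp
    have h2 : Complex.exp (((2 * d * (2 * Real.pi / k) : ℝ) : ℂ) * Complex.I) = 1 := by
      apply mul_right_cancel₀ hp
      rw [← h1, one_mul]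
    rw [Complex.exp_eq_one_iff] at h2
    obtain ⟨n, hn⟩ := h2
    apply hnd
    have h3 : (2 * d : ℂ) = k * n := by
      have hpi : (2 * Real.pi * Complex.I : ℂ) ≠ 0 := Complex.two_pi_I_ne_zero
      apply mul_right_cancel₀ hpi
      push_cast at hn
      have : (2 * d : ℂ) * (2 * Real.pi * Complex.I)
          = k * (2 * d * (2 * Real.pi / k) * Complex.I) := by field_simp
      rw [this, hn]
      ring
    have h4 : ((2 * d : ℕ) : ℤ) = k * n := by exact_mod_cast h3
    exact Int.natCast_dvd_natCast.1 ⟨n, h4⟩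
  constructor
  · rintro ⟨s1, s2, s3⟩
    have hSs : ContDiff ℝ (⊤ : ℕ∞) S := Complex.ofRealCLM.contDiff.comp (s1.add s3)
    obtain ⟨φ₃, _, hφ₃, _, hS3⟩ := aux_equiv 0 S hSs hSα
    have hS4 : ∀ t : ℝ, g₁₁ (t : ℂ) + g₂₂ (t : ℂ) = φ₃ (t^2) := fun t => by
      rw [← hSre, (hS3 t).1, pow_zero, one_mul]
    by_cases hdvd : k ∣ 2 * d
    · left
      have hWs : ContDiff ℝ (⊤ : ℕ∞) W :=
        (Complex.ofRealCLM.contDiff.comp (s1.sub s3)).add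
          ((Complex.ofRealCLM.contDiff.comp (contDiff_const.mul s2)).mul contDiff_const)
      obtain ⟨φ₁, φ₂, h1, h2, h3⟩ := aux_equiv _ W hWs (hWα hdvd)
      refine ⟨hdvd, φ₁, fun x => φ₂ x / 2, φ₃, h1, h2.div_const _, hφ₃, fun t => ⟨?_, ?_, hS4 t⟩⟩
      · rw [← hWre, (h3 t).1]
      · have := (h3 t).2
        rw [hWim] at this
        linear_combination this / 2
    · right
      refine ⟨hdvd, fun t => ?_, φ₃, hφ₃, hS4⟩
      have h1 := hWre t
      have h2 := hWim t
      rw [hW0 hdvd] at h1 h2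
      simp only [Complex.zero_re, Complex.zero_im] at h1 h2
      constructor <;> linarith
  · intro h
    have fin : ContDiff ℝ (⊤ : ℕ∞) W → ContDiff ℝ (⊤ : ℕ∞) S →
        (ContDiff ℝ (⊤ : ℕ∞) g₁₁ ∧ ContDiff ℝ (⊤ : ℕ∞) g₁₂ ∧ ContDiff ℝ (⊤ : ℕ∞) g₂₂) := by
      intro hWs hSs
      have a1 : ContDiff ℝ (⊤ : ℕ∞) (fun p => (W p).re) := Complex.reCLM.contDiff.comp hWs
      have a2 : ContDiff ℝ (⊤ : ℕ∞) (fun p => (W p).im) := Complex.imCLM.contDiff.comp hWs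
      have a3 : ContDiff ℝ (⊤ : ℕ∞) (fun p => (S p).re) := Complex.reCLM.contDiff.comp hSs
      simp only [hWre, hWim, hSre] at a1 a2 a3
      refine ⟨?_, ?_, ?_⟩
      · have e : g₁₁ = fun p => ((g₁₁ p - g₂₂ p) + (g₁₁ p + g₂₂ p)) / 2 := by
          funext p
          ring
        rw [e]
        exact (a1.add a3).div_const 2
      · have e : g₁₂ = fun p => 2 * g₁₂ p / 2 := by
          funext p
          ring
        rw [e]
        exact a2.div_const 2
      · have e : g₂₂ = fun p => ((g₁₁ p + g₂₂ p) - (g₁₁ p - g₂₂ p)) / 2 := by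
          funext p
          ring
        rw [e]
        exact (a3.sub a1).div_const 2
    have hSc : ∀ φ₃ : ℝ → ℝ, ContDiff ℝ (⊤ : ℕ∞) φ₃ →
        (∀ t : ℝ, g₁₁ (t : ℂ) + g₂₂ (t : ℂ) = φ₃ (t^2)) → ContDiff ℝ (⊤ : ℕ∞) S := by
      intro φ₃ h3 h4
      refine aux_conv 0 S hSα φ₃ (fun _ => 0) h3 contDiff_const fun t => ⟨?_, ?_⟩
      · rw [hSre, h4, pow_zero, one_mul]
      · rw [hSim, mul_zero]
    rcases h with ⟨hdvd, φ₁, φ₂, φ₃, h1, h2, h3, h4⟩ | ⟨hdvd, -, φ₃, h3, h4⟩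
    · refine fin ?_ (hSc φ₃ h3 fun t => (h4 t).2.2)
      refine aux_conv _ W (hWα hdvd) φ₁ (fun x => 2 * φ₂ x) h1 (contDiff_const.mul h2)
        fun t => ⟨?_, ?_⟩
      · rw [hWre, (h4 t).1]
      · rw [hWim, (h4 t).2.1]
        ring
    · refine fin ?_ (hSc φ₃ h3 h4)
      have : W = fun _ => 0 := funext (hW0 hdvd)
      rw [this]
      exact contDiff_const
end

section
/- Let k, d, d' be positive integers and let h₁₁, h₁₂, h₂₁, h₂₂ : ℂ → ℝ satisfy, for all θ ∈ ℝ and p ∈ ℂ, the matrix equivariance H(e^{ikθ}p) = R(dθ)·H(p)·R(d'θ)⁻¹, where H(p) = [[h₁₁(p), h₁₂(p)],[h₂₁(p), h₂₂(p)]] and R(α) is the 2×2 rotation matrix by angle α. Then h₁₁, h₁₂, h₂₁, h₂₂ are smooth (C^∞ on ℂ ≅ ℝ²) if and only if the following hold along the real axis: if k divides d' − d there exist smooth φ₁, φ₃ : ℝ → ℝ with (h₁₁ + h₂₂)(t) = t^{|d'−d|/k}·φ₁(t²) and (h₁₂ − h₂₁)(t) = t^{|d'−d|/k}·φ₃(t²)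 for all real t, while if k does not divide d' − d then h₁₁ + h₂₂ and h₁₂ − h₂₁ vanish identically on ℝ; and if k divides d' + d there exist smooth φ₂, φ₄ : ℝ → ℝ with (h₁₁ − h₂₂)(t) = t^{(d'+d)/k}·φ₂(t²) and (h₁₂ + h₂₁)(t) = t^{(d'+d)/k}·φ₄(t²) for all real t, while if k does not divide d' + d then h₁₁ − h₂₂ and h₁₂ + h₂₁ vanish identically on ℝ. -/
/-- Rotation of ℝ² by angle α as a 2×2 matrix. -/
noncomputable def rotMat (α : ℝ) : Matrix (Fin 2) (Fin 2) ℝ :=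
  !![Real.cos α, -Real.sin α; Real.sin α, Real.cos α]

open scoped ContDiff

lemma s8_bump_bound (n k : ℕ) (χ : ContDiffBump (0:ℝ)) :
    ∃ C : ℝ, ∀ x, |iteratedDeriv k (fun x : ℝ => x ^ n * χ x) x| ≤ C := by
  have hc : HasCompactSupport (fun x : ℝ => x ^ n * χ x) := χ.hasCompactSupport.mul_left
  have hs : ContDiff ℝ ∞ (fun x : ℝ => x ^ n * χ x) :=
    (contDiff_id.pow n).mul χ.contDiff
  have h2 := hc.iteratedFDeriv (𝕜 := ℝ) k
  obtain ⟨C, hC⟩ := h2.exists_bound_of_continuous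
    (hs.continuous_iteratedFDeriv (m := k) (by exact_mod_cast le_top))
  refine ⟨C, fun x => ?_⟩
  rw [← Real.norm_eq_abs, ← norm_iteratedFDeriv_eq_norm_iteratedDeriv]
  exact hC x

lemma s8_borel (a : ℕ → ℝ) : ∃ B : ℝ → ℝ, ContDiff ℝ ∞ B ∧ ∀ n, iteratedDeriv n B 0 = a n := by
  let χ : ContDiffBump (0:ℝ) := ⟨1, 2, by norm_num, by norm_num⟩
  choose C hC using fun n k => s8_bump_bound n k χ
  have hC0 : ∀ n k, 0 ≤ C n k := fun n k => (abs_nonneg _).trans (hC n k 0)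
  let P : ℕ → ℝ → ℝ := fun n x => x ^ n * χ x
  have hP : ∀ n, ContDiff ℝ ∞ (P n) := fun n => (contDiff_id.pow n).mul χ.contDiff
  let b : ℕ → ℝ := fun n => a n / n.factorial
  let S : ℕ → ℝ := fun n => ∑ k ∈ Finset.range n, C n k
  have hS : ∀ n, 0 ≤ S n := fun n => Finset.sum_nonneg fun k _ => hC0 n k
  let l : ℕ → ℝ := fun n => 1 + |b n| * S n * 2 ^ n
  have hl : ∀ n, 1 ≤ l n := fun n => by
    have := hS n
    have : 0 ≤ |b n| * S n * 2 ^ n := by positivity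
    simp only [l]; linarith
  have hl0 : ∀ n, 0 < l n := fun n => lt_of_lt_of_le one_pos (hl n)
  let f : ℕ → ℝ → ℝ := fun n x => (b n * (l n ^ n)⁻¹) * P n (l n * x)
  have hf : ∀ n, ContDiff ℝ ∞ (f n) := fun n =>
    contDiff_const.mul ((hP n).comp (contDiff_const.mul contDiff_id))
  have hd : ∀ k n x, iteratedDeriv k (f n) x
      = (b n * (l n ^ n)⁻¹) * (l n ^ k * iteratedDeriv k (P n) (l n * x)) := by
    intro k n x
    have h1 := congrFun (iteratedDeriv_comp_const_mul (n := k) ((hP n).of_le (by exact_mod_cast le_top)) (l n)) x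
    simp only [f]
    rw [iteratedDeriv_const_mul_field, h1]
  let v : ℕ → ℕ → ℝ := fun k n =>
    if k < n then (1/2:ℝ)^n else |b n * (l n ^ n)⁻¹| * (l n ^ k * C n k)
  have hv : ∀ k, Summable (v k) := by
    intro k
    refine (summable_congr_cofinite ?_).2 (summable_geometric_two)
    rw [Nat.cofinite_eq_atTop]
    filter_upwards [Filter.eventually_gt_atTop k] with n hn
    simp [v, hn]
  have hb : ∀ k n x, ‖iteratedFDeriv ℝ k (f n) x‖ ≤ v k n := by
    intro k n x
    rw [norm_iteratedFDeriv_eq_norm_iteratedDeriv, hd, Real.norm_eq_abs, abs_mul, abs_mul (l n ^ k),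
      abs_of_nonneg (pow_nonneg (hl0 n).le k)]
    have h1 : |b n * (l n ^ n)⁻¹| * (l n ^ k * |iteratedDeriv k (P n) (l n * x)|) ≤
      |b n * (l n ^ n)⁻¹| * (l n ^ k * C n k) := by
      have := hl0 n
      gcongr
      exact hC n k _
    refine h1.trans ?_
    simp only [v]
    split_ifs with hkn
    · have hlk : l n ^ k * l n ≤ l n ^ n := by
        rw [← pow_succ]; exact pow_le_pow_right₀ (hl n) hkn
      have hCS : C n k ≤ S n :=
        Finset.single_le_sum (f := fun k => C n k) (fun k _ => hC0 n k) (Finset.mem_range.2 hkn)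
      have h3 : |b n| * S n * 2 ^ n ≤ l n := by simp only [l]; linarith
      have hln := hl0 n
      have hpn : 0 < l n ^ n := pow_pos hln n
      have hpk : 0 < l n ^ k := pow_pos hln k
      rw [abs_mul, abs_of_pos (inv_pos.2 hpn), one_div, inv_pow]
      rw [show |b n| * (l n ^ n)⁻¹ * (l n ^ k * C n k) = (|b n| * C n k * l n ^ k) / l n ^ n by
        field_simp, div_le_iff₀ hpn, inv_mul_eq_div, le_div_iff₀ (by positivity)]
      calc |b n| * C n k * l n ^ k * 2 ^ n = l n ^ k * (|b n| * C n k * 2 ^ n) := by ring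
        _ ≤ l n ^ k * (|b n| * S n * 2 ^ n) := by gcongr
        _ ≤ l n ^ k * l n := by gcongr
        _ ≤ _ := hlk
    · exact le_rfl
  have h0 : ∀ k n, iteratedDeriv k (f n) 0 = if n = k then a k else 0 := by
    intro k n
    rw [hd, mul_zero]
    have he : P n =ᶠ[nhds 0] fun x => x ^ n := by
      filter_upwards [χ.eventuallyEq_one] with x hx
      simp only [P]; rw [hx]; simp
    rw [he.iteratedDeriv_eq, iteratedDeriv_fun_pow_zero]
    have hln := hl0 n
    split_ifs with h1 h2 h2
    · subst h1
      have : (k.factorial : ℝ) ≠ 0 := by positivity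
      simp only [b]; field_simp
    all_goals first | omega | simp
  refine ⟨fun x => ∑' n, f n x, contDiff_tsum (N := ⊤) hf (fun k _ => hv k) (fun k i x _ => hb k i x), ?_⟩
  intro k
  rw [iteratedDeriv_eq_iteratedFDeriv, iteratedFDeriv_tsum_apply (N := ⊤) hf (fun k _ => hv k)
    (fun k i x _ => hb k i x) (by exact_mod_cast le_top), tsum_eq_single k,
    ← iteratedDeriv_eq_iteratedFDeriv, h0, if_pos rfl]
  intro n hn
  rw [← norm_eq_zero, norm_iteratedFDeriv_eq_norm_iteratedDeriv, h0, if_neg hn, norm_zero]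

/-- parametric integrals are smooth -/
lemma s8_param {E : Type*} [NormedAddCommGroup E] [NormedSpace ℝ E] [CompleteSpace E]
    (c : ℝ → ℝ) (hc : Continuous c) (n : ℕ) : ∀ (w : ℝ → ℝ) (_ : Continuous w) (u : ℝ → E)
    (_ : ContDiff ℝ ∞ u), ContDiff ℝ n (fun x => ∫ s in (0:ℝ)..1, w s • u (x * c s)) := by
  have key : ∀ (w : ℝ → ℝ) (_ : Continuous w) (u : ℝ → E) (_ : ContDiff ℝ ∞ u) (x : ℝ),
      HasDerivAt (fun x => ∫ s in (0:ℝ)..1, w s • u (x * c s))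
        (∫ s in (0:ℝ)..1, (w s * c s) • deriv u (x * c s)) x := by
    intro w hw u hu x
    have hu' : Continuous (deriv u) := hu.continuous_deriv (by simp)
    have hcont : Continuous (fun p : ℝ × ℝ => (w p.2 * c p.2) • deriv u (p.1 * c p.2)) := by fun_prop
    obtain ⟨K, hK⟩ := (isCompact_Icc (a := x - 1) (b := x + 1)).prod (isCompact_Icc (a := (0:ℝ)) (b := 1))
      |>.exists_bound_of_continuousOn hcont.continuousOn
    have hucont := hu.continuous
    refine (intervalIntegral.hasDerivAt_integral_of_dominated_loc_of_deriv_le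
      (F := fun x s => w s • u (x * c s)) (F' := fun x s => (w s * c s) • deriv u (x * c s))
      (s := Set.Icc (x-1) (x+1)) (bound := fun _ => K)
      (Icc_mem_nhds (by linarith) (by linarith)) ?_ ?_ ?_ ?_ ?_ ?_).2
    · refine Filter.Eventually.of_forall fun y => ?_
      exact (by fun_prop : Continuous (fun s => w s • u (y * c s))).aestronglyMeasurable
    · exact (by fun_prop : Continuous (fun s => w s • u (x * c s))).intervalIntegrable _ _
    · exact (by fun_prop : Continuous (fun s => (w s * c s) • deriv u (x * c s))).aestronglyMeasurable
    · refine Filter.Eventually.of_forall fun s hs y hy => ?_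
      rw [Set.uIoc_of_le zero_le_one] at hs
      exact hK (y, s) ⟨hy, hs.1.le, hs.2⟩
    · exact intervalIntegrable_const
    · refine Filter.Eventually.of_forall fun s hs y hy => ?_
      have h1 : HasDerivAt u (deriv u (y * c s)) (y * c s) :=
        (hu.differentiable (by simp) _).hasDerivAt
      have h2 := (h1.scomp y ((hasDerivAt_id y).mul_const (c s))).const_smul (w s)
      simp only [one_mul, smul_smul] at h2
      exact h2
  induction n with
  | zero =>
    intro w hw u hu
    exact contDiff_zero.2 (continuous_iff_continuousAt.2 fun x => (key w hw u hu x).continuousAt)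
  | succ n ih =>
    intro w hw u hu
    rw [Nat.cast_succ, contDiff_succ_iff_deriv]
    refine ⟨fun x => (key w hw u hu x).differentiableAt, by simp, ?_⟩
    rw [show deriv (fun x => ∫ s in (0:ℝ)..1, w s • u (x * c s)) = _ from
      funext fun x => (key w hw u hu x).deriv]
    exact ih _ (hw.mul hc) _ ((contDiff_infty_iff_deriv.1 hu).2)

lemma s8_param' {E : Type*} [NormedAddCommGroup E] [NormedSpace ℝ E] [CompleteSpace E]
    (c : ℝ → ℝ) (hc : Continuous c) (w : ℝ → ℝ) (hw : Continuous w) (u : ℝ → E)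
    (hu : ContDiff ℝ ∞ u) : ContDiff ℝ ∞ (fun x => ∫ s in (0:ℝ)..1, w s • u (x * c s)) :=
  contDiff_infty.2 fun n => s8_param c hc n w hw u hu

/-- The operator sending an even smooth function to its derivative divided by twice the variable. -/
lemma s8_L (h : ℝ → ℝ) (hh : ContDiff ℝ ∞ h) (he : ∀ t, h (-t) = h t) :
    ∃ g : ℝ → ℝ, ContDiff ℝ ∞ g ∧ (∀ t, g (-t) = g t) ∧ ∀ t, deriv h t = 2 * t * g t := by
  have h1 : ContDiff ℝ ∞ (deriv h) := (contDiff_infty_iff_deriv.1 hh).2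
  have h2 : ContDiff ℝ ∞ (deriv (deriv h)) := (contDiff_infty_iff_deriv.1 h1).2
  have hodd : ∀ t, deriv h (-t) = - deriv h t := by
    intro t
    have := deriv_comp_neg h t
    rw [show (fun x => h (-x)) = h from funext he] at this
    linarith
  have heven : ∀ t, deriv (deriv h) (-t) = deriv (deriv h) t := by
    intro t
    have h3 := deriv_comp_neg (deriv h) t
    rw [show (fun x => deriv h (-x)) = fun x => - deriv h x from funext hodd, deriv.fun_neg] at h3
    linarith
  refine ⟨fun x => ∫ s in (0:ℝ)..1, (1/2:ℝ) • deriv (deriv h) (x * s),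
    s8_param' (fun s => s) continuous_id (fun _ => 1/2) continuous_const _ h2, ?_, ?_⟩
  · intro t
    simp only [neg_mul, heven]
  · intro t
    have h0 : deriv h 0 = 0 := by have := hodd 0; simp at this; linarith
    have h3 := intervalIntegral.integral_eq_sub_of_hasDerivAt (a := 0) (b := t)
      (f := deriv h) (f' := deriv (deriv h))
      (fun x _ => (h1.differentiable (by simp) x).hasDerivAt)
      (h2.continuous.intervalIntegrable _ _)
    have h4 := intervalIntegral.smul_integral_comp_mul_left (a := 0) (b := 1) (deriv (deriv h)) t
    simp only [mul_zero, mul_one, smul_eq_mul] at h4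
    rw [h3, h0, sub_zero] at h4
    rw [← h4]
    simp only [smul_eq_mul]
    rw [intervalIntegral.integral_const_mul]
    ring

/-- gluing -/
lemma s8_glue (n : ℕ) : ∀ (h : ℕ → ℝ → ℝ) (_ : ∀ i, ContDiff ℝ ∞ (h i))
    (_ : ∀ i t, deriv (h i) t = 2 * t * h (i+1) t) (B : ℝ → ℝ) (_ : ContDiff ℝ ∞ B)
    (_ : ∀ i, iteratedDeriv i B 0 = h i 0),
    ContDiff ℝ n (fun x => if 0 ≤ x then h 0 (Real.sqrt x) else B x) := by
  have hcont : ∀ (h : ℝ → ℝ) (B : ℝ → ℝ), Continuous h → Continuous B → B 0 = h 0 →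
      Continuous (fun x => if 0 ≤ x then h (Real.sqrt x) else B x) := by
    intro h B hh hB h0
    refine Continuous.if_le (by fun_prop) hB continuous_const continuous_id ?_
    intro x hx
    rw [← hx]; simp [h0]
  induction n with
  | zero =>
    intro h hh hd B hB h0
    refine contDiff_zero.2 (hcont _ _ (hh 0).continuous hB.continuous ?_)
    simpa using h0 0
  | succ n ih =>
    intro h hh hd B hB h0
    have hB' := (contDiff_infty_iff_deriv.1 hB).2
    have h0' : ∀ i, iteratedDeriv i (deriv B) 0 = h (i+1) 0 := by
      intro i; rw [← iteratedDeriv_succ', h0]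
    have key : ∀ x, HasDerivAt (fun x => if 0 ≤ x then h 0 (Real.sqrt x) else B x)
        (if 0 ≤ x then h 1 (Real.sqrt x) else deriv B x) x := by
      intro x
      refine hasDerivAt_of_hasDerivAt_of_ne' (x := 0)
        (g := fun x => if 0 ≤ x then h 1 (Real.sqrt x) else deriv B x) ?_ ?_ ?_ x
      · intro y hy
        rcases lt_or_gt_of_ne hy with hy | hy
        · rw [if_neg (not_le.2 hy)]
          refine (hB.differentiable (by simp) y).hasDerivAt.congr_of_eventuallyEq ?_
          filter_upwards [gt_mem_nhds hy] with z hz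
          rw [if_neg (not_le.2 hz)]
        · rw [if_pos hy.le]
          have hs := Real.sqrt_pos.2 hy
          have h1 : HasDerivAt (h 0) (2 * Real.sqrt y * h 1 (Real.sqrt y)) (Real.sqrt y) := by
            rw [← hd 0]; exact ((hh 0).differentiable (by simp) _).hasDerivAt
          have h2 := h1.comp y (Real.hasDerivAt_sqrt hy.ne')
          have h3 : 2 * Real.sqrt y * h 1 (Real.sqrt y) * (1 / (2 * Real.sqrt y)) = h 1 (Real.sqrt y) := by
            field_simp
          rw [h3] at h2
          refine h2.congr_of_eventuallyEq ?_
          filter_upwards [lt_mem_nhds hy] with z hz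
          rw [if_pos hz.le]; rfl
      · exact (hcont _ _ (hh 0).continuous hB.continuous (by simpa using h0 0)).continuousAt
      · exact (hcont _ _ (hh 1).continuous hB'.continuous (by simpa using h0' 0)).continuousAt
    rw [Nat.cast_succ, contDiff_succ_iff_deriv]
    refine ⟨fun x => (key x).differentiableAt, by simp, ?_⟩
    rw [show deriv (fun x => if 0 ≤ x then h 0 (Real.sqrt x) else B x) = _ from
      funext fun x => (key x).deriv]
    exact ih (fun i => h (i+1)) (fun i => hh _) (fun i => hd _) (deriv B) hB' h0'

lemma s8_whitney (h : ℝ → ℝ) (hh : ContDiff ℝ ∞ h) (he : ∀ t, h (-t) = h t) :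
    ∃ φ : ℝ → ℝ, ContDiff ℝ ∞ φ ∧ ∀ t, h t = φ (t ^ 2) := by
  let T := {h : ℝ → ℝ // ContDiff ℝ ∞ h ∧ ∀ t, h (-t) = h t}
  have hL : ∀ p : T, ∃ q : T, ∀ t, deriv p.1 t = 2 * t * q.1 t := by
    rintro ⟨p, hp, hpe⟩
    obtain ⟨g, hg, hge, hd⟩ := s8_L p hp hpe
    exact ⟨⟨g, hg, hge⟩, hd⟩
  choose L hL using hL
  let H : ℕ → T := fun n => L^[n] ⟨h, hh, he⟩
  obtain ⟨B, hB, hB0⟩ := s8_borel (fun n => (H n).1 0)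
  refine ⟨fun x => if 0 ≤ x then (H 0).1 (Real.sqrt x) else B x, contDiff_infty.2 fun n =>
    s8_glue n (fun i => (H i).1) (fun i => (H i).2.1) ?_ B hB hB0, ?_⟩
  · intro i t
    simp only [H, Function.iterate_succ_apply']
    exact hL _ t
  · intro t
    simp only [if_pos (sq_nonneg t), Real.sqrt_sq_eq_abs]
    change h t = h |t|
    rcases abs_choice t with h1 | h1 <;> rw [h1]
    exact (he t).symm

lemma s8_core_fwd (m : ℕ) : ∀ (f : ℂ → ℂ) (_ : ContDiff ℝ ∞ f)
    (_ : ∀ c : ℂ, ‖c‖ = 1 → ∀ p, f (c * p) = c ^ m * f p),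
    ∃ φ : ℝ → ℂ, ContDiff ℝ ∞ φ ∧ ∀ t : ℝ, f t = (t : ℂ) ^ m * φ (t ^ 2) := by
  induction m with
  | zero =>
    intro f hf he
    have hg : ContDiff ℝ ∞ (fun t : ℝ => f t) := hf.comp Complex.ofRealCLM.contDiff
    have hgr : ContDiff ℝ ∞ (fun t : ℝ => (f t).re) := Complex.reCLM.contDiff.comp hg
    have hgi : ContDiff ℝ ∞ (fun t : ℝ => (f t).im) := Complex.imCLM.contDiff.comp hg
    have hev : ∀ t : ℝ, f ((-t : ℝ) : ℂ) = f t := by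
      intro t
      have := he (-1) (by simp) t
      simpa using this
    obtain ⟨φ, hφ, h1⟩ := s8_whitney _ hgr (fun t => by simp only [hev])
    obtain ⟨ψ, hψ, h2⟩ := s8_whitney _ hgi (fun t => by simp only [hev])
    refine ⟨fun x => (φ x : ℂ) + (ψ x : ℂ) * Complex.I, ?_, ?_⟩
    · exact (Complex.ofRealCLM.contDiff.comp hφ).add
        ((Complex.ofRealCLM.contDiff.comp hψ).mul contDiff_const)
    · intro t
      change _ = _ * ((φ (t ^ 2) : ℂ) + (ψ (t ^ 2) : ℂ) * Complex.I)
      rw [pow_zero, one_mul, ← h1, ← h2, Complex.re_add_im]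
  | succ m ih =>
    intro f hf he
    have hdf : Differentiable ℝ f := hf.differentiable (by simp)
    let D : ℂ → ℂ := fun p => fderiv ℝ f p 1 - Complex.I * fderiv ℝ f p Complex.I
    have hfd : ContDiff ℝ ∞ (fderiv ℝ f) := (contDiff_infty_iff_fderiv.1 hf).2
    have hD : ContDiff ℝ ∞ D :=
      (hfd.clm_apply contDiff_const).sub (contDiff_const.mul (hfd.clm_apply contDiff_const))
    have hDe : ∀ c : ℂ, ‖c‖ = 1 → ∀ p, D (c * p) = c ^ m * D p := by
      intro c hc p
      have hcc : c * (starRingEnd ℂ) c = 1 := by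
        rw [Complex.mul_conj, Complex.normSq_eq_norm_sq, hc]; simp
      have h1 : ∀ w : ℂ, fderiv ℝ f (c * p) (c * w) = c ^ (m+1) * fderiv ℝ f p w := by
        intro w
        have e1 : HasFDerivAt (fun p : ℂ => f (c * p))
            ((fderiv ℝ f (c * p)).comp (c • (ContinuousLinearMap.id ℝ ℂ))) p :=
          HasFDerivAt.comp p (hdf (c * p)).hasFDerivAt ((hasFDerivAt_id p).const_mul c)
        have e2 : HasFDerivAt (fun p : ℂ => f (c * p)) (c ^ (m+1) • fderiv ℝ f p) p := by
          rw [show (fun p : ℂ => f (c * p)) = fun p => c ^ (m+1) * f p from funext (he c hc)]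
          exact (hdf p).hasFDerivAt.const_mul _
        have e3 := congrArg (fun l : ℂ →L[ℝ] ℂ => l w) (e1.unique e2)
        simpa using e3
      have lin : ∀ x y : ℝ, fderiv ℝ f p ((x : ℂ) + y * Complex.I)
          = x * fderiv ℝ f p 1 + y * fderiv ℝ f p Complex.I := by
        intro x y
        have : (x : ℂ) + y * Complex.I = x • (1:ℂ) + y • Complex.I := by simp
        rw [this, map_add, map_smul, map_smul]; simp
      have hcr : (starRingEnd ℂ) c = (c.re : ℂ) + ((-c.im : ℝ) : ℂ) * Complex.I := by
        apply Complex.ext <;> simp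
      have hcI : (starRingEnd ℂ) c * Complex.I = (c.im : ℂ) + (c.re : ℂ) * Complex.I := by
        apply Complex.ext <;> simp
      have a1 : fderiv ℝ f (c * p) 1 = c ^ (m+1) * (c.re * fderiv ℝ f p 1 + (-c.im : ℝ) * fderiv ℝ f p Complex.I) := by
        rw [← lin, ← hcr, ← h1, hcc]
      have a2 : fderiv ℝ f (c * p) Complex.I = c ^ (m+1) * (c.im * fderiv ℝ f p 1 + c.re * fderiv ℝ f p Complex.I) := by
        rw [← lin, ← hcI, ← h1, ← mul_assoc, hcc, one_mul]
      simp only [D]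
      rw [a1, a2]
      have : c ^ m = c ^ (m+1) * (starRingEnd ℂ) c := by rw [pow_succ, mul_assoc, hcc, mul_one]
      rw [this, hcr]
      push_cast
      linear_combination (-c ^ (m+1) * c.im * fderiv ℝ f p Complex.I) * Complex.I_sq
    obtain ⟨ψ, hψ, hψe⟩ := ih D hD hDe
    have hder : ∀ t : ℝ, HasDerivAt (fun t : ℝ => f t) (fderiv ℝ f t 1) t := by
      intro t
      have := (hdf (t : ℂ)).hasFDerivAt.comp_hasDerivAt t (Complex.ofRealCLM.hasDerivAt (x := t))
      simp only [Complex.ofRealCLM_apply, Complex.ofReal_one] at this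
      exact this
    have hB : ∀ t : ℝ, (t : ℂ) * fderiv ℝ f t Complex.I = Complex.I * (m+1) * f t := by
      intro t
      have e0 : HasDerivAt (fun α : ℝ => Complex.exp (α * Complex.I)) Complex.I 0 := by
        have := ((Complex.ofRealCLM.hasDerivAt (x := 0)).mul_const Complex.I).cexp
        simpa using this
      have e1 : HasDerivAt (fun α : ℝ => f (Complex.exp (α * Complex.I) * t))
          (fderiv ℝ f t (Complex.I * t)) 0 := by
        have h3 : HasFDerivAt f (fderiv ℝ f t) (Complex.exp (((0:ℝ):ℂ) * Complex.I) * t) := by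
          simpa using (hdf (t : ℂ)).hasFDerivAt
        exact h3.comp_hasDerivAt (0:ℝ) (e0.mul_const (t : ℂ))
      have e2 : HasDerivAt (fun α : ℝ => f (Complex.exp (α * Complex.I) * t))
          (Complex.I * (m+1) * f t) 0 := by
        rw [show (fun α : ℝ => f (Complex.exp (α * Complex.I) * t)) =
          fun α : ℝ => Complex.exp (α * Complex.I) ^ (m+1) * f t from
          funext fun α => he _ (Complex.norm_exp_ofReal_mul_I α) t]
        have := (e0.pow (m+1)).mul_const (f t)
        simp at this
        exact this.congr_deriv (by ring)
      rw [← e1.unique e2, show Complex.I * (t:ℂ) = t • Complex.I by simp [mul_comm], map_smul]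
      simp
    have hode : ∀ t : ℝ, (t : ℂ) * D t = t * fderiv ℝ f t 1 + (m+1) * f t := by
      intro t
      simp only [D]
      linear_combination (-Complex.I) * hB t - (m+1) * f t * Complex.I_sq
    refine ⟨fun x => ∫ s in (0:ℝ)..1, (s ^ (2*m+1)) • ψ (x * s ^ 2),
      s8_param' (fun s => s ^ 2) (by fun_prop) (fun s => s ^ (2*m+1)) (by fun_prop) ψ hψ, ?_⟩
    intro t
    by_cases ht : t = 0
    · subst ht
      have := hode 0
      have hm : (m + 1 : ℂ) ≠ 0 := by exact_mod_cast Nat.succ_ne_zero m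
      simp at this
      have h3 : f 0 = 0 := this.resolve_left hm
      simp [h3]
    · have hψc := hψ.continuous
      let q : ℝ → ℂ := fun s => (s ^ (2*m+1)) • ψ (s ^ 2)
      have hq : Continuous q := by fun_prop
      have e1 : ∀ s : ℝ, HasDerivAt (fun s : ℝ => (s : ℂ) ^ (m+1) * f s) (q s) s := by
        intro s
        have h3 := ((Complex.ofRealCLM.hasDerivAt (x := s)).pow (m+1)).mul (hder s)
        refine HasDerivAt.congr_deriv h3 ?_
        simp only [Pi.pow_apply, Complex.ofRealCLM_apply, Complex.ofReal_one, Nat.add_sub_cancel]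
        have h4 := hode s
        rw [hψe s] at h4
        simp only [q, Complex.real_smul]
        push_cast
        linear_combination (-(s : ℂ) ^ m) * h4
      have e2 := intervalIntegral.integral_eq_sub_of_hasDerivAt (a := 0) (b := t)
        (fun x _ => e1 x) (hq.intervalIntegrable _ _)
      have e3 := intervalIntegral.smul_integral_comp_mul_left (a := 0) (b := 1) q t
      simp only [mul_zero, mul_one] at e3
      rw [e2] at e3
      have e4 : ∀ s : ℝ, q (t * s) = t ^ (2*m+1) • ((s ^ (2*m+1)) • ψ (t ^ 2 * s ^ 2)) := by
        intro s
        simp only [q, smul_smul, mul_pow]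
      simp only [e4] at e3
      rw [intervalIntegral.integral_smul] at e3
      simp only [Complex.real_smul] at e3 ⊢
      push_cast at e3 ⊢
      have htc : (t : ℂ) ^ (m+1) ≠ 0 := pow_ne_zero _ (by exact_mod_cast ht)
      apply mul_left_cancel₀ htc
      simp only [ne_eq, Nat.succ_ne_zero, not_false_eq_true, zero_pow, zero_mul, sub_zero] at e3
      rw [← e3]
      ring

lemma s8_core_bwd (m : ℕ) (f : ℂ → ℂ)
    (he : ∀ c : ℂ, ‖c‖ = 1 → ∀ p, f (c * p) = c ^ m * f p)
    (φ : ℝ → ℂ) (hφ : ContDiff ℝ ∞ φ) (h : ∀ t : ℝ, f t = (t : ℂ) ^ m * φ (t ^ 2)) :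
    ContDiff ℝ ∞ f := by
  have : f = fun z => z ^ m * φ (‖z‖ ^ 2) := by
    funext z
    have h1 : z = Complex.exp (z.arg * Complex.I) * (‖z‖ : ℝ) := by
      rw [mul_comm, Complex.norm_mul_exp_arg_mul_I]
    have h2 := he _ (Complex.norm_exp_ofReal_mul_I z.arg) (‖z‖ : ℝ)
    rw [← h1, h, ← mul_assoc, ← mul_pow, ← h1] at h2
    exact h2
  rw [this]
  exact (contDiff_id.pow m).mul (hφ.comp (contDiff_norm_sq ℝ))

lemma s8_pair (k n : ℕ) (hk : 0 < k) (a b : ℂ → ℝ)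
    (h : ∀ (θ : ℝ) (p : ℂ),
      a (Complex.exp (Complex.I * ((k : ℝ) * θ)) * p)
        = Real.cos (n * θ) * a p - Real.sin (n * θ) * b p ∧
      b (Complex.exp (Complex.I * ((k : ℝ) * θ)) * p)
        = Real.sin (n * θ) * a p + Real.cos (n * θ) * b p) :
    (ContDiff ℝ ∞ a ∧ ContDiff ℝ ∞ b) ↔
      ((k ∣ n → ∃ φ ψ : ℝ → ℝ, ContDiff ℝ ∞ φ ∧ ContDiff ℝ ∞ ψ ∧
        ∀ t : ℝ, a t = t ^ (n / k) * φ (t ^ 2) ∧ b t = t ^ (n / k) * ψ (t ^ 2)) ∧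
       (¬ k ∣ n → ∀ t : ℝ, a t = 0 ∧ b t = 0)) := by
  let F : ℂ → ℂ := fun p => (a p : ℂ) + (b p : ℂ) * Complex.I
  have hk0 : (k : ℝ) ≠ 0 := by exact_mod_cast hk.ne'
  have hkc : (k : ℂ) ≠ 0 := by exact_mod_cast hk.ne'
  have hF : ∀ (θ : ℝ) (p : ℂ), F (Complex.exp (Complex.I * ((k : ℝ) * θ)) * p)
      = Complex.exp (((n * θ : ℝ) : ℂ) * Complex.I) * F p := by
    intro θ p
    simp only [F]
    rw [(h θ p).1, (h θ p).2, Complex.exp_mul_I, ← Complex.ofReal_cos, ← Complex.ofReal_sin]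
    generalize Real.cos (n * θ) = C
    generalize Real.sin (n * θ) = S
    push_cast
    linear_combination (-(S:ℂ) * b p) * Complex.I_sq
  have hFa : ∀ p, (F p).re = a p := fun p => by simp [F]
  have hFb : ∀ p, (F p).im = b p := fun p => by simp [F]
  have hFs : (ContDiff ℝ ∞ a ∧ ContDiff ℝ ∞ b) ↔ ContDiff ℝ ∞ F := by
    constructor
    · rintro ⟨ha, hb⟩
      exact (Complex.ofRealCLM.contDiff.comp ha).add
        ((Complex.ofRealCLM.contDiff.comp hb).mul contDiff_const)
    · intro hs
      constructor
      · rw [show a = fun p => (F p).re from funext fun p => (hFa p).symm]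
        exact Complex.reCLM.contDiff.comp hs
      · rw [show b = fun p => (F p).im from funext fun p => (hFb p).symm]
        exact Complex.imCLM.contDiff.comp hs
  rw [hFs]
  by_cases hdvd : k ∣ n
  · obtain ⟨m, rfl⟩ := hdvd
    have hm : k * m / k = m := Nat.mul_div_cancel_left m hk
    have he : ∀ c : ℂ, ‖c‖ = 1 → ∀ p, F (c * p) = c ^ m * F p := by
      intro c hc p
      have h1 : Complex.exp (c.arg * Complex.I) = c := by
        have := Complex.norm_mul_exp_arg_mul_I c
        rwa [hc, Complex.ofReal_one, one_mul] at this
      have h2 := hF (c.arg / k) p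
      have e1 : Complex.I * (((k : ℝ) : ℂ) * ((c.arg / k : ℝ) : ℂ)) = c.arg * Complex.I := by
        push_cast; field_simp
      have e2 : ((((k * m : ℕ) : ℝ) * (c.arg / k) : ℝ) : ℂ) * Complex.I = m * (c.arg * Complex.I) := by
        push_cast; field_simp
      rw [e1, e2, Complex.exp_nat_mul, h1] at h2
      exact h2
    simp only [hm, dvd_mul_right, not_true_eq_false, false_imp_iff, and_true, true_imp_iff]
    constructor
    · intro hs
      obtain ⟨φ, hφ, h1⟩ := s8_core_fwd m F hs he
      refine ⟨fun x => (φ x).re, fun x => (φ x).im, Complex.reCLM.contDiff.comp hφ,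
        Complex.imCLM.contDiff.comp hφ, fun t => ?_⟩
      rw [← hFa, ← hFb, h1, ← Complex.ofReal_pow, Complex.re_ofReal_mul, Complex.im_ofReal_mul]
      exact ⟨rfl, rfl⟩
    · rintro ⟨φ, ψ, hφ, hψ, h1⟩
      refine s8_core_bwd m F he (fun x => (φ x : ℂ) + (ψ x : ℂ) * Complex.I)
        ((Complex.ofRealCLM.contDiff.comp hφ).add
        ((Complex.ofRealCLM.contDiff.comp hψ).mul contDiff_const)) fun t => ?_
      simp only [F]
      rw [(h1 t).1, (h1 t).2]
      push_cast
      ring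
  · have hz : ∀ p, F p = 0 := by
      intro p
      have h2 := hF (2 * Real.pi / k) p
      have e1 : Complex.I * (((k : ℝ) : ℂ) * ((2 * Real.pi / k : ℝ) : ℂ)) = 2 * Real.pi * Complex.I := by
        push_cast; field_simp
      rw [e1, Complex.exp_two_pi_mul_I, one_mul] at h2
      by_contra hne
      have h3 : Complex.exp (((n * (2 * Real.pi / k) : ℝ) : ℂ) * Complex.I) = 1 := by
        apply mul_right_cancel₀ hne
        rw [← h2, one_mul]
      obtain ⟨j, hj⟩ := Complex.exp_eq_one_iff.1 h3
      apply hdvd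
      have hpi : (Real.pi : ℂ) ≠ 0 := by exact_mod_cast Real.pi_ne_zero
      have h4 : (n : ℂ) = k * j := by
        push_cast at hj
        field_simp at hj
        have hI := Complex.I_ne_zero
        linear_combination hj
      have h5 : (n : ℤ) = k * j := by exact_mod_cast h4
      exact Int.natCast_dvd_natCast.1 ⟨j, h5⟩
    simp only [hdvd, false_imp_iff, true_and, not_false_eq_true, true_imp_iff]
    constructor
    · intro _ t
      rw [← hFa, ← hFb, hz]; simp
    · intro _
      rw [show F = fun _ => 0 from funext hz]
      exact contDiff_const


lemma s8_pair_neg (k n : ℕ) (hk : 0 < k) (a b : ℂ → ℝ)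
    (h : ∀ (θ : ℝ) (p : ℂ),
      a (Complex.exp (Complex.I * ((k : ℝ) * θ)) * p)
        = Real.cos (n * θ) * a p + Real.sin (n * θ) * b p ∧
      b (Complex.exp (Complex.I * ((k : ℝ) * θ)) * p)
        = - Real.sin (n * θ) * a p + Real.cos (n * θ) * b p) :
    (ContDiff ℝ ∞ a ∧ ContDiff ℝ ∞ b) ↔
      ((k ∣ n → ∃ φ ψ : ℝ → ℝ, ContDiff ℝ ∞ φ ∧ ContDiff ℝ ∞ ψ ∧
        ∀ t : ℝ, a t = t ^ (n / k) * φ (t ^ 2) ∧ b t = t ^ (n / k) * ψ (t ^ 2)) ∧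
       (¬ k ∣ n → ∀ t : ℝ, a t = 0 ∧ b t = 0)) := by
  have key := s8_pair k n hk a (fun p => - b p) (fun θ p =>
    ⟨by rw [(h θ p).1]; ring, by rw [(h θ p).2]; ring⟩)
  have hb : ContDiff ℝ ∞ (fun p => - b p) ↔ ContDiff ℝ ∞ b :=
    ⟨fun h => by simpa using h.neg, fun h => h.neg⟩
  rw [hb] at key
  rw [key]
  refine and_congr (imp_congr_right fun _ => ?_) (imp_congr_right fun _ => ?_)
  · constructor
    · rintro ⟨φ, ψ, hφ, hψ, h1⟩
      exact ⟨φ, fun x => - ψ x, hφ, hψ.neg, fun t => ⟨(h1 t).1, by linarith [(h1 t).2]⟩⟩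
    · rintro ⟨φ, ψ, hφ, hψ, h1⟩
      exact ⟨φ, fun x => - ψ x, hφ, hψ.neg, fun t => ⟨(h1 t).1, by linarith [(h1 t).2]⟩⟩
  · simp

lemma s8_rot_inv (α : ℝ) : (rotMat α)⁻¹ =
    !![Real.cos α, Real.sin α; -Real.sin α, Real.cos α] := by
  apply Matrix.inv_eq_right_inv
  have := Real.sin_sq_add_cos_sq α
  ext i j
  fin_cases i <;> fin_cases j <;> simp [rotMat, Matrix.mul_apply, Fin.sum_univ_two] <;> linarith

theorem stmt_8 (k d d' : ℕ) (hk : 0 < k) (hd : 0 < d) (hd' : 0 < d')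
    (h₁₁ h₁₂ h₂₁ h₂₂ : ℂ → ℝ)
    (hH : ∀ (θ : ℝ) (p : ℂ),
      (!![h₁₁ (Complex.exp (Complex.I * ((k : ℝ) * θ)) * p),
          h₁₂ (Complex.exp (Complex.I * ((k : ℝ) * θ)) * p);
          h₂₁ (Complex.exp (Complex.I * ((k : ℝ) * θ)) * p),
          h₂₂ (Complex.exp (Complex.I * ((k : ℝ) * θ)) * p)] : Matrix (Fin 2) (Fin 2) ℝ)
        = rotMat ((d : ℝ) * θ) * !![h₁₁ p, h₁₂ p; h₂₁ p, h₂₂ p] * (rotMat ((d' : ℝ) * θ))⁻¹) :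
    (ContDiff ℝ (⊤ : ℕ∞) h₁₁ ∧ ContDiff ℝ (⊤ : ℕ∞) h₁₂ ∧ ContDiff ℝ (⊤ : ℕ∞) h₂₁ ∧ ContDiff ℝ (⊤ : ℕ∞) h₂₂)
    ↔
    ((((k : ℤ) ∣ ((d' : ℤ) - (d : ℤ)) →
        ∃ φ₁ φ₃ : ℝ → ℝ, ContDiff ℝ (⊤ : ℕ∞) φ₁ ∧ ContDiff ℝ (⊤ : ℕ∞) φ₃ ∧
          ∀ t : ℝ,
            h₁₁ (t : ℂ) + h₂₂ (t : ℂ) = t ^ (((d' : ℤ) - (d : ℤ)).natAbs / k) * φ₁ (t^2) ∧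
            h₁₂ (t : ℂ) - h₂₁ (t : ℂ) = t ^ (((d' : ℤ) - (d : ℤ)).natAbs / k) * φ₃ (t^2)) ∧
      (¬ ((k : ℤ) ∣ ((d' : ℤ) - (d : ℤ))) →
        ∀ t : ℝ, h₁₁ (t : ℂ) + h₂₂ (t : ℂ) = 0 ∧ h₁₂ (t : ℂ) - h₂₁ (t : ℂ) = 0))
     ∧
     ((k ∣ (d' + d) →
        ∃ φ₂ φ₄ : ℝ → ℝ, ContDiff ℝ (⊤ : ℕ∞) φ₂ ∧ ContDiff ℝ (⊤ : ℕ∞) φ₄ ∧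
          ∀ t : ℝ,
            h₁₁ (t : ℂ) - h₂₂ (t : ℂ) = t ^ ((d' + d) / k) * φ₂ (t^2) ∧
            h₁₂ (t : ℂ) + h₂₁ (t : ℂ) = t ^ ((d' + d) / k) * φ₄ (t^2)) ∧
      (¬ (k ∣ (d' + d)) →
        ∀ t : ℝ, h₁₁ (t : ℂ) - h₂₂ (t : ℂ) = 0 ∧ h₁₂ (t : ℂ) + h₂₁ (t : ℂ) = 0))) := by
  have hent : ∀ (θ : ℝ) (p : ℂ),
      (h₁₁ (Complex.exp (Complex.I * ((k : ℝ) * θ)) * p) + h₂₂ (Complex.exp (Complex.I * ((k : ℝ) * θ)) * p)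
        = Real.cos (d' * θ - d * θ) * (h₁₁ p + h₂₂ p) - Real.sin (d' * θ - d * θ) * (h₁₂ p - h₂₁ p)) ∧
      (h₁₂ (Complex.exp (Complex.I * ((k : ℝ) * θ)) * p) - h₂₁ (Complex.exp (Complex.I * ((k : ℝ) * θ)) * p)
        = Real.sin (d' * θ - d * θ) * (h₁₁ p + h₂₂ p) + Real.cos (d' * θ - d * θ) * (h₁₂ p - h₂₁ p)) ∧
      (h₁₁ (Complex.exp (Complex.I * ((k : ℝ) * θ)) * p) - h₂₂ (Complex.exp (Complex.I * ((k : ℝ) * θ)) * p)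
        = Real.cos (d' * θ + d * θ) * (h₁₁ p - h₂₂ p) - Real.sin (d' * θ + d * θ) * (h₁₂ p + h₂₁ p)) ∧
      (h₁₂ (Complex.exp (Complex.I * ((k : ℝ) * θ)) * p) + h₂₁ (Complex.exp (Complex.I * ((k : ℝ) * θ)) * p)
        = Real.sin (d' * θ + d * θ) * (h₁₁ p - h₂₂ p) + Real.cos (d' * θ + d * θ) * (h₁₂ p + h₂₁ p)) := by
    intro θ p
    have hm := hH θ p
    rw [s8_rot_inv] at hm
    have e00 := congrFun (congrFun hm 0) 0
    have e01 := congrFun (congrFun hm 0) 1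
    have e10 := congrFun (congrFun hm 1) 0
    have e11 := congrFun (congrFun hm 1) 1
    simp only [rotMat, Matrix.mul_apply, Fin.sum_univ_two, Matrix.of_apply, Matrix.cons_val_zero,
      Matrix.cons_val_one, Matrix.cons_val', Matrix.cons_val_fin_one] at e00 e01 e10 e11
    rw [e00, e01, e10, e11, Real.cos_sub, Real.sin_sub, Real.cos_add, Real.sin_add]
    refine ⟨?_, ?_, ?_, ?_⟩ <;> ring
  have hsm : (ContDiff ℝ (⊤ : ℕ∞) h₁₁ ∧ ContDiff ℝ (⊤ : ℕ∞) h₁₂ ∧ ContDiff ℝ (⊤ : ℕ∞) h₂₁ ∧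
      ContDiff ℝ (⊤ : ℕ∞) h₂₂) ↔
      ((ContDiff ℝ ∞ (fun p => h₁₁ p + h₂₂ p) ∧ ContDiff ℝ ∞ (fun p => h₁₂ p - h₂₁ p)) ∧
       (ContDiff ℝ ∞ (fun p => h₁₁ p - h₂₂ p) ∧ ContDiff ℝ ∞ (fun p => h₁₂ p + h₂₁ p))) := by
    constructor
    · rintro ⟨a, b, c, e⟩
      exact ⟨⟨a.add e, b.sub c⟩, a.sub e, b.add c⟩
    · rintro ⟨⟨a, b⟩, c, e⟩
      refine ⟨?_, ?_, ?_, ?_⟩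
      · have := (a.add c).div_const 2
        refine (congrArg (ContDiff ℝ ∞) (funext fun p => ?_)).mp this
        change _ = h₁₁ p
        ring
      · have := (e.add b).div_const 2
        refine (congrArg (ContDiff ℝ ∞) (funext fun p => ?_)).mp this
        change _ = h₁₂ p
        ring
      · have := (e.sub b).div_const 2
        refine (congrArg (ContDiff ℝ ∞) (funext fun p => ?_)).mp this
        change _ = h₂₁ p
        ring
      · have := (a.sub c).div_const 2
        refine (congrArg (ContDiff ℝ ∞) (funext fun p => ?_)).mp this
        change _ = h₂₂ p
        ring
  rw [hsm]
  refine and_congr ?_ ?_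
  · have hdv : ((k : ℤ) ∣ ((d' : ℤ) - (d : ℤ))) ↔ k ∣ ((d' : ℤ) - (d : ℤ)).natAbs :=
      Int.natCast_dvd
    rw [hdv]
    rcases le_total d d' with hle | hle
    · refine s8_pair k _ hk (fun p => h₁₁ p + h₂₂ p) (fun p => h₁₂ p - h₂₁ p) fun θ p => ?_
      have hn : ((((d' : ℤ) - (d : ℤ)).natAbs : ℕ) : ℝ) = d' - d := by
        have : (((d' : ℤ) - (d : ℤ)).natAbs : ℤ) = d' - d := by omega
        exact_mod_cast this
      rw [hn, sub_mul]
      exact ⟨(hent θ p).1, (hent θ p).2.1⟩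
    · refine s8_pair_neg k _ hk (fun p => h₁₁ p + h₂₂ p) (fun p => h₁₂ p - h₂₁ p) fun θ p => ?_
      have hn : ((((d' : ℤ) - (d : ℤ)).natAbs : ℕ) : ℝ) = -(d' - d) := by
        have : (((d' : ℤ) - (d : ℤ)).natAbs : ℤ) = -(d' - d) := by omega
        have h2 := congrArg (Int.cast : ℤ → ℝ) this
        rw [Int.cast_natCast] at h2
        rw [h2]
        push_cast
        ring
      rw [hn, neg_mul, sub_mul, Real.cos_neg, Real.sin_neg, neg_neg, neg_mul, ← sub_eq_add_neg]
      exact ⟨(hent θ p).1, (hent θ p).2.1⟩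
  · refine s8_pair k _ hk (fun p => h₁₁ p - h₂₂ p) (fun p => h₁₂ p + h₂₁ p) fun θ p => ?_
    rw [Nat.cast_add, add_mul]
    exact (hent θ p).2.2
end
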